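/- Let f : U → ℂ^p be a holomorphic map on an open set U ⊆ ℂⁿ all of whose level sets X_c = f⁻¹(c), c in a neighbourhood T of 0, are geometric complete intersections (pure dimension n − p). If a sequence of parameters c_ν ∈ T converges to c₀ ∈ T, then the level sets X_{c_ν} converge to X_{c₀} in the topology of local uniform convergence on closed subsets of U. -/

import Mathlib

open Filter Topology

/-- The ring of germs at a point `a ∈ ℂⁿ` of holomorphic functions, realized as the
subring of germs at `a` of functions analytic at `a`. -/
noncomputable def AnalyticGermRingAt {n : ℕ} (a : Fin n → ℂ) : Subring (Filter.Germ (𝓝 a) ℂ) where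
  carrier := {g | ∃ f : (Fin n → ℂ) → ℂ, AnalyticAt ℂ f a ∧ g = (f : Filter.Germ (𝓝 a) ℂ)}
  one_mem' := ⟨fun _ => 1, analyticAt_const, rfl⟩
  zero_mem' := ⟨fun _ => 0, analyticAt_const, rfl⟩
  mul_mem' := by
    rintro x y ⟨f, hf, rfl⟩ ⟨g, hg, rfl⟩
    exact ⟨fun y => f y * g y, hf.mul hg, rfl⟩
  add_mem' := by
    rintro x y ⟨f, hf, rfl⟩ ⟨g, hg, rfl⟩
    exact ⟨fun y => f y + g y, hf.add hg, rfl⟩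
  neg_mem' := by
    rintro x ⟨f, hf, rfl⟩
    exact ⟨fun y => - f y, hf.neg, rfl⟩

/-- The germ at `a` of a function analytic at `a`, as an element of the germ ring. -/
noncomputable def analyticGermAt {n : ℕ} (a : Fin n → ℂ) (f : (Fin n → ℂ) → ℂ)
    (hf : AnalyticAt ℂ f a) : AnalyticGermRingAt a :=
  ⟨(f : Filter.Germ (𝓝 a) ℂ), f, hf, rfl⟩



abbrev KB (n : ℕ) (r : ℝ) := Metric.closedBall (0 : Fin n → ℂ) r

noncomputable def crdC (n : ℕ) (r : ℝ) (i : Fin n) : C(KB n r, ℂ) :=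
  ⟨fun z => z.1 i, (continuous_apply i).comp continuous_subtype_val⟩

noncomputable def HA (n : ℕ) (r : ℝ) : Subalgebra ℂ C(KB n r, ℂ) :=
  (Algebra.adjoin ℂ (Set.range (crdC n r))).topologicalClosure

noncomputable instance HA_ncr (n : ℕ) (r : ℝ) : NormedCommRing (HA n r) := inferInstance
noncomputable instance HA_cr (n : ℕ) (r : ℝ) : CommRing (HA n r) := inferInstance
noncomputable instance HA_na (n : ℕ) (r : ℝ) : NormedAlgebra ℂ (HA n r) := inferInstance
noncomputable instance HA_nag (n : ℕ) (r : ℝ) : NormedAddCommGroup (HA n r) := inferInstance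
noncomputable instance HA_ns (n : ℕ) (r : ℝ) : NormedSpace ℂ (HA n r) := inferInstance

instance HA_complete (n : ℕ) (r : ℝ) : CompleteSpace (HA n r) :=
  (Subalgebra.isClosed_topologicalClosure _).isComplete.completeSpace_coe

lemma HA_isClosed (n : ℕ) (r : ℝ) : IsClosed (HA n r : Set C(KB n r, ℂ)) :=
  Subalgebra.isClosed_topologicalClosure _

lemma crdC_mem {n : ℕ} {r : ℝ} (i : Fin n) : crdC n r i ∈ HA n r :=
  Subalgebra.le_topologicalClosure _ (Algebra.subset_adjoin ⟨i, rfl⟩)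

noncomputable def crd (n : ℕ) (r : ℝ) (i : Fin n) : HA n r := ⟨crdC n r i, crdC_mem i⟩

lemma HA_le {n : ℕ} {r : ℝ} (A : Subalgebra ℂ C(KB n r, ℂ)) (hA : IsClosed (A : Set C(KB n r, ℂ)))
    (h : ∀ i, crdC n r i ∈ A) : HA n r ≤ A := by
  apply Subalgebra.topologicalClosure_minimal _ hA
  rw [Algebra.adjoin_le_iff]
  rintro _ ⟨i, rfl⟩
  exact h i

lemma HA_comp_mem {n m : ℕ} {r s : ℝ} (φ : C(KB m s, KB n r))
    (hφ : ∀ i, (crdC n r i).comp φ ∈ HA m s) {h : C(KB n r, ℂ)} (hh : h ∈ HA n r) :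
    h.comp φ ∈ HA m s := by
  have := HA_le ((HA m s).comap (ContinuousMap.compRightAlgHom ℂ ℂ φ))
    ((HA_isClosed m s).preimage (ContinuousMap.continuous_precomp φ)) hφ
  exact this hh

/-- composition operator -/
noncomputable def compH {n m : ℕ} {r s : ℝ} (φ : C(KB m s, KB n r))
    (hφ : ∀ i, (crdC n r i).comp φ ∈ HA m s) : HA n r →L[ℂ] HA m s :=
  LinearMap.mkContinuous
    { toFun := fun h => ⟨h.1.comp φ, HA_comp_mem φ hφ h.2⟩
      map_add' := fun _ _ => rfl
      map_smul' := fun _ _ => rfl } 1 (by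
    intro h
    rw [one_mul]
    change ‖h.1.comp φ‖ ≤ ‖h.1‖
    rw [ContinuousMap.norm_le _ (norm_nonneg _)]
    intro x
    exact h.1.norm_coe_le_norm (φ x))

lemma compH_apply {n m : ℕ} {r s : ℝ} (φ : C(KB m s, KB n r))
    (hφ : ∀ i, (crdC n r i).comp φ ∈ HA m s) (h : HA n r) (z : KB m s) :
    (compH φ hφ h).1 z = h.1 (φ z) := rfl

noncomputable def projC (n : ℕ) (r : ℝ) (i : Fin n) : C(KB n r, KB n r) :=
  ⟨fun z => ⟨Function.update z.1 i 0, by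
    have hz := z.2
    rw [mem_closedBall_zero_iff] at hz ⊢
    rw [pi_norm_le_iff_of_nonneg ((norm_nonneg _).trans hz)]
    intro j
    by_cases h : j = i
    · subst h; simpa using (norm_nonneg _).trans hz
    · simpa [h] using (norm_le_pi_norm z.1 j).trans hz⟩,
   Continuous.subtype_mk (by fun_prop) _⟩

lemma projC_mem (n : ℕ) (r : ℝ) (i j : Fin n) : (crdC n r j).comp (projC n r i) ∈ HA n r := by
  by_cases h : j = i
  · have : (crdC n r j).comp (projC n r i) = 0 := by
      ext z; simp [crdC, projC, h]
    rw [this]; exact zero_mem _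
  · have : (crdC n r j).comp (projC n r i) = crdC n r j := by
      ext z; simp [crdC, projC, h]
    rw [this]; exact crdC_mem _

noncomputable def EH (n : ℕ) (r : ℝ) (i : Fin n) : HA n r →L[ℂ] HA n r :=
  compH (projC n r i) (projC_mem n r i)

/-- slices of elements of the adjoin extend to entire functions -/
lemma adjoin_entire {n : ℕ} {r : ℝ} {h : C(KB n r, ℂ)}
    (hh : h ∈ Algebra.adjoin ℂ (Set.range (crdC n r))) :
    ∃ p : (Fin n → ℂ) → ℂ, Differentiable ℂ p ∧ ∀ z : KB n r, h z = p z.1 := by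
  induction hh using Algebra.adjoin_induction with
  | mem x hx =>
    obtain ⟨i, rfl⟩ := hx
    exact ⟨fun z => z i, by fun_prop, fun z => rfl⟩
  | algebraMap c => exact ⟨fun _ => c, by fun_prop, fun z => rfl⟩
  | add x y _ _ hx hy =>
    obtain ⟨p, hp, hp'⟩ := hx
    obtain ⟨q, hq, hq'⟩ := hy
    exact ⟨fun z => p z + q z, hp.add hq, fun z => by simp [hp', hq']⟩
  | mul x y _ _ hx hy =>
    obtain ⟨p, hp, hp'⟩ := hx
    obtain ⟨q, hq, hq'⟩ := hy
    exact ⟨fun z => p z * q z, hp.mul hq, fun z => by simp [hp', hq']⟩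

lemma adjoin_bound {n : ℕ} {r : ℝ} (hr : 0 < r) (i : Fin n) {h : C(KB n r, ℂ)}
    (hh : h ∈ Algebra.adjoin ℂ (Set.range (crdC n r))) :
    ‖h‖ ≤ r⁻¹ * ‖crdC n r i * h‖ := by
  obtain ⟨p, hp, hp'⟩ := adjoin_entire hh
  rw [ContinuousMap.norm_le _ (by positivity)]
  intro z
  have hz := mem_closedBall_zero_iff.1 z.2
  have hup : ∀ t : ℂ, ‖t‖ ≤ r → Function.update z.1 i t ∈ Metric.closedBall (0 : Fin n → ℂ) r := by
    intro t ht
    rw [mem_closedBall_zero_iff, pi_norm_le_iff_of_nonneg hr.le]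
    intro j
    by_cases h : j = i
    · subst h; simpa using ht
    · simpa [h] using (norm_le_pi_norm z.1 j).trans hz
  have hd : Differentiable ℂ (fun t : ℂ => p (Function.update z.1 i t)) := by
    apply hp.comp
    rw [differentiable_pi]
    intro j
    by_cases h : j = i
    · subst h; simp
    · simp [h]
  have := Complex.norm_le_of_forall_mem_frontier_norm_le (U := Metric.ball (0 : ℂ) r)
    Metric.isBounded_ball hd.diffContOnCl (C := r⁻¹ * ‖crdC n r i * h‖) (by
      intro t ht
      rw [frontier_ball _ hr.ne', mem_sphere_zero_iff_norm] at ht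
      have h1 := (crdC n r i * h).norm_coe_le_norm ⟨_, hup t ht.le⟩
      rw [ContinuousMap.mul_apply, norm_mul, hp'] at h1
      simp only [crdC, ContinuousMap.coe_mk, Function.update_self, ht] at h1
      rw [inv_mul_eq_div, le_div_iff₀ hr, mul_comm]
      exact h1) (z := z.1 i) (by
        rw [closure_ball _ hr.ne', mem_closedBall_zero_iff]
        exact (norm_le_pi_norm z.1 i).trans hz)
  simpa [hp'] using this

lemma HA_bound {n : ℕ} {r : ℝ} (hr : 0 < r) (i : Fin n) (h : HA n r) :
    ‖h‖ ≤ r⁻¹ * ‖crd n r i * h‖ := by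
  have hcl : IsClosed {h : C(KB n r, ℂ) | ‖h‖ ≤ r⁻¹ * ‖crdC n r i * h‖} :=
    isClosed_le (by fun_prop) (by fun_prop)
  have := closure_minimal (fun h hh => adjoin_bound hr i hh) hcl
  exact this h.2

noncomputable def mulH {n : ℕ} {r : ℝ} (a : HA n r) : HA n r →L[ℂ] HA n r :=
  ContinuousLinearMap.mul ℂ (HA n r) a

lemma mulH_apply {n : ℕ} {r : ℝ} (a b : HA n r) : mulH a b = a * b := rfl

lemma EH_mul {n : ℕ} {r : ℝ} (i : Fin n) (a b : HA n r) :
    EH n r i (a * b) = EH n r i a * EH n r i b := rfl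

lemma antilip {n : ℕ} {r : ℝ} (hr : 0 < r) (i : Fin n) :
    AntilipschitzWith (⟨r⁻¹, by positivity⟩ : NNReal) (mulH (crd n r i)) := 
  AddMonoidHomClass.antilipschitz_of_bound _ fun x => HA_bound hr i x

lemma mem_range_mul {n : ℕ} {r : ℝ} (hr : 0 < r) (i : Fin n) (h : HA n r) :
    ∃ q : HA n r, h - EH n r i h = crd n r i * q := by
  have hcl : IsClosed (Set.range (mulH (crd n r i))) :=
    (antilip hr i).isClosed_range (mulH (crd n r i)).uniformContinuous
  let A : Subalgebra ℂ (HA n r) :=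
    { carrier := {h | ∃ q : HA n r, h - EH n r i h = crd n r i * q}
      mul_mem' := by
        rintro a b ⟨q, hq⟩ ⟨q', hq'⟩
        refine ⟨q * b + EH n r i a * q', ?_⟩
        rw [EH_mul]
        linear_combination hq * b + EH n r i a * hq'
      add_mem' := by
        rintro a b ⟨q, hq⟩ ⟨q', hq'⟩
        refine ⟨q + q', ?_⟩
        rw [map_add]
        linear_combination hq + hq'
      algebraMap_mem' := by
        intro c
        refine ⟨0, ?_⟩
        rw [mul_zero, sub_eq_zero]
        rfl }
  have hA : IsClosed (A : Set (HA n r)) := by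
    have : (A : Set (HA n r)) = (fun h => h - EH n r i h) ⁻¹' Set.range (mulH (crd n r i)) := by
      ext h
      constructor
      · rintro ⟨q, hq⟩; exact ⟨q, hq.symm⟩
      · rintro ⟨q, hq⟩; exact ⟨q, hq.symm⟩
    rw [this]
    exact hcl.preimage (by fun_prop)
  have hle := HA_le (A.map (HA n r).val) (by
    exact ((HA_isClosed n r).isClosedEmbedding_subtypeVal).isClosedMap _ hA) (by
    intro j
    refine ⟨crd n r j, ?_, rfl⟩
    by_cases h : j = i
    · subst h
      refine ⟨1, ?_⟩
      have : EH n r j (crd n r j) = 0 := by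
        apply Subtype.ext; ext z
        simp [EH, compH_apply, crd, crdC, projC]
      rw [this]; simp
    · refine ⟨0, ?_⟩
      have : EH n r i (crd n r j) = crd n r j := by
        apply Subtype.ext; ext z
        simp [EH, compH_apply, crd, crdC, projC, h]
      rw [this]; simp)
  obtain ⟨a, ha, hh⟩ := hle h.2
  have : a = h := Subtype.ext hh
  exact this ▸ ha

/-- the division operator -/
lemma exists_DH {n : ℕ} {r : ℝ} (hr : 0 < r) (i : Fin n) :
    ∃ D : HA n r →L[ℂ] HA n r, ∀ h, h = EH n r i h + crd n r i * D h := by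
  choose q hq using mem_range_mul hr i
  have inj : Function.Injective (mulH (crd n r i)) := (antilip hr i).injective
  let L : HA n r →ₗ[ℂ] HA n r :=
    { toFun := q
      map_add' := by
        intro a b
        apply inj
        rw [map_add]
        simp only [mulH_apply]
        rw [← hq, ← hq, ← hq, map_add]; ring
      map_smul' := by
        intro c a
        apply inj
        rw [RingHom.id_apply, map_smul]
        simp only [mulH_apply]
        rw [← hq, ← hq, map_smul, smul_sub] }
  refine ⟨L.mkContinuous (r⁻¹ * ‖ContinuousLinearMap.id ℂ (HA n r) - EH n r i‖) ?_, ?_⟩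
  · intro h
    refine (HA_bound hr i (q h)).trans ?_
    rw [← hq, mul_assoc]
    gcongr
    exact (ContinuousLinearMap.id ℂ (HA n r) - EH n r i).le_opNorm h
  · intro h
    have := hq h
    change h = EH n r i h + crd n r i * q h
    rw [← this]; ring


noncomputable def projS (n : ℕ) (r : ℝ) (s : Finset (Fin n)) : C(KB n r, KB n r) :=
  ⟨fun z => ⟨fun j => if j ∈ s then 0 else z.1 j, by
    have hz := z.2
    rw [mem_closedBall_zero_iff] at hz ⊢
    rw [pi_norm_le_iff_of_nonneg ((norm_nonneg _).trans hz)]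
    intro j
    by_cases h : j ∈ s
    · simpa [h] using (norm_nonneg _).trans hz
    · simpa [h] using (norm_le_pi_norm z.1 j).trans hz⟩,
   Continuous.subtype_mk (by
    refine continuous_pi fun j => ?_
    by_cases h : j ∈ s
    · simp [h, continuous_const]
    · simp only [h, if_false]
      exact (continuous_apply j).comp continuous_subtype_val) _⟩

lemma projS_mem (n : ℕ) (r : ℝ) (s : Finset (Fin n)) (j : Fin n) :
    (crdC n r j).comp (projS n r s) ∈ HA n r := by
  by_cases h : j ∈ s
  · have : (crdC n r j).comp (projS n r s) = 0 := by
      ext z; simp [crdC, projS, h]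
    rw [this]; exact zero_mem _
  · have : (crdC n r j).comp (projS n r s) = crdC n r j := by
      ext z; simp [crdC, projS, h]
    rw [this]; exact crdC_mem _

noncomputable def ES (n : ℕ) (r : ℝ) (s : Finset (Fin n)) : HA n r →L[ℂ] HA n r :=
  compH (projS n r s) (projS_mem n r s)

lemma ES_empty (n : ℕ) (r : ℝ) (h : HA n r) : ES n r ∅ h = h := by
  apply Subtype.ext; ext z
  simp [ES, compH_apply, projS]

lemma ES_insert {n : ℕ} {r : ℝ} (s : Finset (Fin n)) (i : Fin n) (h : HA n r) :
    ES n r s (EH n r i h) = ES n r (insert i s) h := by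
  apply Subtype.ext; ext z
  simp only [ES, EH, compH_apply]
  congr 1
  apply Subtype.ext; funext j
  by_cases hj : j = i
  · subst hj; simp [projS, projC]
  · simp [projS, projC, hj]

lemma ES_crd_mul {n : ℕ} {r : ℝ} {s : Finset (Fin n)} {i : Fin n} (hi : i ∉ s) (h : HA n r) :
    ES n r s (crd n r i * h) = crd n r i * ES n r s h := by
  have h1 : ES n r s (crd n r i * h) = ES n r s (crd n r i) * ES n r s h := rfl
  have h2 : ES n r s (crd n r i) = crd n r i := by
    apply Subtype.ext; ext z
    simp [ES, compH_apply, projS, crd, crdC, hi]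
  rw [h1, h2]

lemma ES_crd_pow_mul {n : ℕ} {r : ℝ} {s : Finset (Fin n)} {i : Fin n} (hi : i ∉ s) (k : ℕ)
    (h : HA n r) : ES n r s (crd n r i ^ k * h) = crd n r i ^ k * ES n r s h := by
  induction k with
  | zero => simp
  | succ k ih => rw [pow_succ', mul_assoc, ES_crd_mul hi, ih, mul_assoc]

noncomputable def mon (n : ℕ) (r : ℝ) {N : ℕ} (α : Fin n → Fin (N + 1)) : HA n r :=
  ∏ i, crd n r i ^ (α i : ℕ)

def GoodSet {n q : ℕ} {r : ℝ} (N : ℕ) (F : Fin q → HA n r) (s : Finset (Fin n)) :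
    Set (HA n r →L[ℂ] HA n r) :=
  {T | ∃ (P : HA n r →L[ℂ] ℂ) (α : Fin n → Fin (N + 1)), (∀ i ∈ s, α i = 0) ∧
    T = P.smulRight (mon n r α)} ∪
  {T | ∃ (j : Fin q) (S : HA n r →L[ℂ] HA n r), T = (mulH (F j)).comp S}

lemma good_comp {n q : ℕ} {r : ℝ} (N : ℕ) (F : Fin q → HA n r) (s : Finset (Fin n))
    (T B : HA n r →L[ℂ] HA n r) (hT : T ∈ Submodule.span ℂ (GoodSet N F s)) :
    T.comp B ∈ Submodule.span ℂ (GoodSet N F s) := by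
  induction hT using Submodule.span_induction with
  | mem x h =>
    apply Submodule.subset_span
    rcases h with ⟨P, α, hα, rfl⟩ | ⟨j, S, rfl⟩
    · exact Or.inl ⟨P.comp B, α, hα, by ext; rfl⟩
    · exact Or.inr ⟨j, S.comp B, by ext; rfl⟩
  | zero => simp
  | add x y _ _ hx hy => rw [ContinuousLinearMap.add_comp]; exact add_mem hx hy
  | smul a x _ hx => rw [ContinuousLinearMap.smul_comp]; exact Submodule.smul_mem _ _ hx

lemma good_mul {n q : ℕ} {r : ℝ} (N : ℕ) (F : Fin q → HA n r) (s : Finset (Fin n)) (i : Fin n)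
    (hi : i ∉ s) (k : ℕ) (hk : k < N + 1)
    (T : HA n r →L[ℂ] HA n r) (hT : T ∈ Submodule.span ℂ (GoodSet N F (insert i s))) :
    (mulH (crd n r i ^ k)).comp T ∈ Submodule.span ℂ (GoodSet N F s) := by
  induction hT using Submodule.span_induction with
  | mem x h =>
    apply Submodule.subset_span
    rcases h with ⟨P, α, hα, rfl⟩ | ⟨j, S, rfl⟩
    · refine Or.inl ⟨P, Function.update α i ⟨k, hk⟩, ?_, ?_⟩
      · intro j hj
        have : j ≠ i := fun h => hi (h ▸ hj)
        simpa [this] using hα j (Finset.mem_insert_of_mem hj)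
      · apply ContinuousLinearMap.ext
        intro h
        simp only [ContinuousLinearMap.comp_apply, ContinuousLinearMap.smulRight_apply, mulH_apply]
        rw [mul_smul_comm]
        congr 1
        unfold mon
        rw [← Finset.mul_prod_erase _ _ (Finset.mem_univ i),
          ← Finset.mul_prod_erase _ (fun j => crd n r j ^ ((Function.update α i ⟨k, hk⟩ j : Fin (N+1)) : ℕ)) (Finset.mem_univ i)]
        rw [hα i (Finset.mem_insert_self _ _)]
        simp only [Function.update_self, Fin.val_zero, pow_zero, one_mul]
        congr 1
        apply Finset.prod_congr rfl
        intro j hj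
        rw [Function.update_of_ne (Finset.ne_of_mem_erase hj)]
    · refine Or.inr ⟨j, (mulH (crd n r i ^ k)).comp S, ?_⟩
      apply ContinuousLinearMap.ext
      intro h
      simp only [ContinuousLinearMap.comp_apply, mulH_apply]
      ring
  | zero => simp
  | add x y _ _ hx hy => rw [ContinuousLinearMap.comp_add]; exact add_mem hx hy
  | smul a x _ hx => rw [ContinuousLinearMap.comp_smul]; exact Submodule.smul_mem _ _ hx

lemma taylor {n : ℕ} {r : ℝ} (i : Fin n) (D : HA n r →L[ℂ] HA n r)
    (hD : ∀ h, h = EH n r i h + crd n r i * D h) (M : ℕ) (h : HA n r) :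
    h = ∑ k ∈ Finset.range M, crd n r i ^ k * EH n r i ((D ^ k) h) + crd n r i ^ M * (D ^ M) h := by
  induction M with
  | zero => simp
  | succ M ih =>
    rw [Finset.sum_range_succ]
    have e : (D ^ (M + 1)) h = D ((D ^ M) h) := by rw [pow_succ']; rfl
    have := hD ((D ^ M) h)
    rw [e]
    linear_combination ih + crd n r i ^ M * this

lemma ES_good {n q : ℕ} {r : ℝ} (hr : 0 < r) (N : ℕ) (F : Fin q → HA n r)
    (a : Fin n → Fin q → HA n r) (ha : ∀ i, crd n r i ^ (N + 1) = ∑ j, a i j * F j)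
    (t : Finset (Fin n)) : ES n r tᶜ ∈ Submodule.span ℂ (GoodSet N F tᶜ) := by
  induction t using Finset.induction_on with
  | empty =>
    apply Submodule.subset_span
    refine Or.inl ⟨((ContinuousMap.evalCLM ℂ (⟨0, by simpa using hr.le⟩ : KB n r))).comp
      ((HA n r).toSubmodule.subtypeL), 0, fun i _ => rfl, ?_⟩
    apply ContinuousLinearMap.ext
    intro h
    apply Subtype.ext
    ext z
    simp only [ES, compH_apply, ContinuousLinearMap.smulRight_apply]
    have : projS n r (∅ᶜ) z = ⟨0, by simpa using hr.le⟩ := by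
      apply Subtype.ext; funext j; simp [projS]
    rw [this]
    simp [mon]
    rfl
  | insert i t hi ih =>
    obtain ⟨D, hD⟩ := exists_DH hr i
    have hins : insert i (insert i t)ᶜ = tᶜ := by
      ext j; by_cases h : j = i <;> simp [h, hi]
    have hni : i ∉ (insert i t)ᶜ := by simp
    have key : ES n r (insert i t)ᶜ = (∑ k ∈ Finset.range (N + 1),
        (mulH (crd n r i ^ k)).comp ((ES n r tᶜ).comp (D ^ k))) +
        ∑ j, (mulH (F j)).comp ((mulH (a i j)).comp ((ES n r (insert i t)ᶜ).comp (D ^ (N+1)))) := by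
      apply ContinuousLinearMap.ext
      intro h
      conv_lhs => rw [taylor i D hD (N + 1) h]
      rw [map_add, map_sum]
      simp only [ContinuousLinearMap.add_apply, ContinuousLinearMap.sum_apply,
        ContinuousLinearMap.comp_apply, mulH_apply]
      congr 1
      · apply Finset.sum_congr rfl
        intro k _
        rw [ES_crd_pow_mul hni, ES_insert, hins]
      · rw [ES_crd_pow_mul hni, ha, Finset.sum_mul]
        apply Finset.sum_congr rfl
        intro j _
        ring
    rw [key]
    apply add_mem
    · apply sum_mem
      intro k hk
      apply good_mul N F _ i hni k (Finset.mem_range.1 hk)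
      rw [hins]
      exact good_comp _ _ _ _ _ ih
    · apply sum_mem
      intro j _
      exact Submodule.subset_span (Or.inr ⟨j, _, rfl⟩)

lemma decomp {n q : ℕ} {r : ℝ} (hr : 0 < r) (N : ℕ) (F : Fin q → HA n r)
    (a : Fin n → Fin q → HA n r) (ha : ∀ i, crd n r i ^ (N + 1) = ∑ j, a i j * F j) :
    ∃ (P : (Fin n → Fin (N + 1)) → (HA n r →L[ℂ] ℂ)) (S : Fin q → (HA n r →L[ℂ] HA n r)),
      ∀ h, h = ∑ α, P α h • mon n r α + ∑ j, F j * S j h := by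
  have h1 := ES_good hr N F a ha Finset.univ
  have : ∀ T ∈ Submodule.span ℂ (GoodSet N F (Finset.univᶜ)),
    ∃ (P : (Fin n → Fin (N + 1)) → (HA n r →L[ℂ] ℂ)) (S : Fin q → (HA n r →L[ℂ] HA n r)),
      ∀ h, T h = ∑ α, P α h • mon n r α + ∑ j, F j * S j h := by
    intro T hT
    induction hT using Submodule.span_induction with
    | mem x h =>
      rcases h with ⟨P, α, -, rfl⟩ | ⟨j, S, rfl⟩
      · refine ⟨Pi.single α P, 0, fun h => ?_⟩
        rw [Finset.sum_eq_single α]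
        · simp only [Pi.single_eq_same, ContinuousLinearMap.smulRight_apply, Pi.zero_apply, ContinuousLinearMap.zero_apply, mul_zero, Finset.sum_const_zero, add_zero]
        · intro b _ hb; simp only [Pi.single_eq_of_ne hb, ContinuousLinearMap.zero_apply, zero_smul]
        · intro h; exact absurd (Finset.mem_univ _) h
      · refine ⟨0, Pi.single j S, fun h => ?_⟩
        rw [Finset.sum_eq_single (s := Finset.univ) (f := fun j' => F j' * (Pi.single j S : Fin q → (HA n r →L[ℂ] HA n r)) j' h) j]
        · simp only [Pi.single_eq_same, ContinuousLinearMap.comp_apply, mulH_apply, Pi.zero_apply, ContinuousLinearMap.zero_apply, zero_smul, Finset.sum_const_zero, zero_add]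
        · intro b _ hb; simp only [Pi.single_eq_of_ne hb, ContinuousLinearMap.zero_apply, mul_zero]
        · intro h; exact absurd (Finset.mem_univ _) h
    | zero => exact ⟨0, 0, fun h => by simp only [Pi.zero_apply, ContinuousLinearMap.zero_apply, zero_smul, mul_zero, Finset.sum_const_zero, add_zero]⟩
    | add x y _ _ hx hy =>
      obtain ⟨P, S, h⟩ := hx
      obtain ⟨P', S', h'⟩ := hy
      refine ⟨P + P', S + S', fun g => ?_⟩
      simp only [ContinuousLinearMap.add_apply, Pi.add_apply, h, h', add_smul, mul_add, Finset.sum_add_distrib]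
      abel
    | smul c x _ hx =>
      obtain ⟨P, S, h⟩ := hx
      refine ⟨c • P, c • S, fun g => ?_⟩
      simp only [ContinuousLinearMap.smul_apply, Pi.smul_apply, h, Finset.smul_sum, smul_add, smul_assoc, mul_smul_comm]
  obtain ⟨P, S, h⟩ := this _ h1
  refine ⟨P, S, fun g => ?_⟩
  rw [← h, Finset.compl_univ, ES_empty]

lemma resolventX {X : Type*} [NormedAddCommGroup X] [NormedSpace ℂ X] [CompleteSpace X] {q : ℕ}
    (S : Fin q → (X →L[ℂ] X)) :
    ∃ δ > 0, ∃ G : (Fin q → ℂ) → X →L[ℂ] X,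
      (∀ (P : X →L[ℂ] ℂ) (h : X), AnalyticOnNhd ℂ (fun w => P (G w h)) (Metric.ball 0 δ)) ∧
      ∀ w ∈ Metric.ball (0 : Fin q → ℂ) δ, ∀ h, G w h = h + ∑ j, w j • S j (G w h) := by
  let L : (Fin q → ℂ) →L[ℂ] (X →L[ℂ] X) :=
    ∑ j, (ContinuousLinearMap.proj j).smulRight (S j)
  have hL : ∀ w, L w = ∑ j, w j • S j := by
    intro w; simp [L]
  have hnhds : {w | ‖L w‖ < 1} ∈ 𝓝 (0 : Fin q → ℂ) := by
    apply (isOpen_lt (by fun_prop) continuous_const).mem_nhds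
    simp
  obtain ⟨δ, hδ, hball⟩ := Metric.mem_nhds_iff.1 hnhds
  have hunit : ∀ w ∈ Metric.ball (0 : Fin q → ℂ) δ, IsUnit (1 - L w) := fun w hw =>
    isUnit_one_sub_of_norm_lt_one (hball hw)
  refine ⟨δ, hδ, fun w => Ring.inverse (1 - L w), ?_, ?_⟩
  · intro P h w hw
    obtain ⟨u, hu⟩ := hunit w hw
    have h1 : AnalyticAt ℂ (fun w => 1 - L w) w := analyticAt_const.sub (L.analyticAt w)
    have h2 : AnalyticAt ℂ (Ring.inverse : (X →L[ℂ] X) → _) (1 - L w) := by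
      rw [← hu]; exact analyticAt_inverse u
    have h3 : AnalyticAt ℂ (fun w => Ring.inverse (1 - L w)) w :=
      AnalyticAt.comp (g := (Ring.inverse : (X →L[ℂ] X) → _)) (f := fun w => 1 - L w) h2 h1
    have h4 := (P.comp (ContinuousLinearMap.apply ℂ X h)).analyticAt
      (Ring.inverse (1 - L w))
    exact AnalyticAt.comp (g := fun T => (P.comp (ContinuousLinearMap.apply ℂ X h)) T)
      (f := fun w => Ring.inverse (1 - L w)) h4 h3
  · intro w hw h
    have := Ring.mul_inverse_cancel _ (hunit w hw)
    have := congrArg (fun T : X →L[ℂ] X => T h) this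
    simp only [ContinuousLinearMap.mul_apply, ContinuousLinearMap.sub_apply, hL,
      ContinuousLinearMap.one_apply, ContinuousLinearMap.sum_apply,
      ContinuousLinearMap.smul_apply, sub_eq_iff_eq_add] at this
    simpa only [hL] using this

lemma FL {n q : ℕ} {r : ℝ} (hr : 0 < r) (N : ℕ) (F : Fin q → HA n r)
    (a : Fin n → Fin q → HA n r) (ha : ∀ i, crd n r i ^ (N + 1) = ∑ j, a i j * F j) :
    ∃ δ > 0, ∃ k : (Fin n → Fin (N + 1)) → HA n r → (Fin q → ℂ) → ℂ,
      (∀ α h, AnalyticOnNhd ℂ (k α h) (Metric.ball 0 δ)) ∧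
      ∀ (h : HA n r) (z : KB n r), (fun j => (F j).1 z) ∈ Metric.ball (0 : Fin q → ℂ) δ →
        h.1 z = ∑ α, k α h (fun j => (F j).1 z) * (mon n r α).1 z := by
  obtain ⟨P, S, hPS⟩ := decomp hr N F a ha
  obtain ⟨δ, hδ, G, hG1, hG2⟩ := resolventX S
  refine ⟨δ, hδ, fun α h w => P α (G w h), fun α h => hG1 _ _, ?_⟩
  intro h z hz
  set w : Fin q → ℂ := fun j => (F j).1 z with hw
  set h' := G w h with hh'
  have e1 : h' = h + ∑ j, w j • S j h' := hG2 w hz h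
  let ev : HA n r →ₐ[ℂ] ℂ := (ContinuousMap.evalAlgHom ℂ ℂ z).comp (HA n r).val
  have hev : ∀ g, ev g = g.1 z := fun g => rfl
  have e2 := congrArg ev (hPS h')
  have e3 := congrArg ev e1
  simp only [map_add, map_sum, map_smul, map_mul, smul_eq_mul] at e2 e3
  simp only [← hev] at hw ⊢
  rw [e2] at e3
  have : ∑ j, ev (F j) * ev (S j h') = ∑ j, w j * ev (S j h') := rfl
  rw [this] at e3
  exact (add_right_cancel e3).symm


lemma multilin_mem {n : ℕ} (r : ℝ) (k : ℕ)
    (p : ContinuousMultilinearMap ℂ (fun _ : Fin k => (Fin n → ℂ)) ℂ) :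
    ∃ g : HA n r, ∀ z : KB n r, g.1 z = p (fun _ => z.1) := by
  refine ⟨∑ s : Fin k → Fin n, p (fun l => Pi.single (s l) (1:ℂ)) • ∏ l, crd n r (s l), ?_⟩
  intro z
  have hz : (fun _ : Fin k => z.1) = fun _ : Fin k => ∑ i, z.1 i • Pi.single i (1 : ℂ) := by
    funext _
    exact pi_eq_sum_univ' z.1
  rw [hz]
  let ev : HA n r →ₐ[ℂ] ℂ := (ContinuousMap.evalAlgHom ℂ ℂ z).comp (HA n r).val
  have hev : ∀ g, ev g = g.1 z := fun g => rfl
  rw [ContinuousMultilinearMap.map_sum, ← hev]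
  simp only [map_sum, map_smul, map_prod, ContinuousMultilinearMap.map_smul_univ]
  refine Finset.sum_congr rfl fun s _ => ?_
  rw [smul_eq_mul, smul_eq_mul, mul_comm]
  rfl

lemma H1 {n : ℕ} {f : (Fin n → ℂ) → ℂ} (hf : AnalyticAt ℂ f 0) :
    ∀ᶠ r in 𝓝[>] (0:ℝ), ∃ g : HA n r, ∀ z : KB n r, g.1 z = f z.1 := by
  obtain ⟨p, ρ, hp⟩ := hf
  obtain ⟨ρ', h0, h1⟩ := ENNReal.lt_iff_exists_nnreal_btwn.1 hp.r_pos
  have h0' : (0:ℝ) < ρ' := by exact_mod_cast h0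
  filter_upwards [Ioo_mem_nhdsGT h0'] with r hr
  have hsub : ∀ z : KB n r, z.1 ∈ Metric.ball (0 : Fin n → ℂ) ρ' := fun z =>
    Metric.closedBall_subset_ball hr.2 z.2
  have hunif := hp.tendstoUniformlyOn h1
  have hcont : ContinuousOn f (Metric.ball (0 : Fin n → ℂ) ρ') := by
    refine hp.continuousOn.mono ?_
    intro z hz
    rw [Metric.mem_eball]
    rw [Metric.mem_ball] at hz
    refine lt_trans ?_ h1
    rw [edist_dist, ← ENNReal.ofReal_coe_nnreal]
    exact (ENNReal.ofReal_lt_ofReal_iff h0').2 hz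
  let g : C(KB n r, ℂ) := ⟨fun z => f z.1, hcont.comp_continuous continuous_subtype_val hsub⟩
  choose q hq using fun k => multilin_mem r k (p k)
  have hT : Tendsto (fun N : ℕ => (∑ k ∈ Finset.range N, q k : HA n r).1) atTop (𝓝 g) := by
    rw [ContinuousMap.tendsto_iff_tendstoUniformly]
    rw [Metric.tendstoUniformlyOn_iff] at hunif
    rw [Metric.tendstoUniformly_iff]
    intro ε hε
    filter_upwards [hunif ε hε] with N hN z
    have := hN z.1 (hsub z)
    rw [zero_add] at this
    have e : ((∑ k ∈ Finset.range N, q k : HA n r).1) z = p.partialSum N z.1 := ?_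
    · rw [e]; exact this
    let ev : HA n r →ₐ[ℂ] ℂ := (ContinuousMap.evalAlgHom ℂ ℂ z).comp (HA n r).val
    change ev _ = _
    rw [map_sum]
    exact Finset.sum_congr rfl fun k _ => hq k z
  have hg : g ∈ HA n r := (HA_isClosed n r).mem_of_tendsto hT (Eventually.of_forall fun N => Subtype.mem _)
  exact ⟨⟨g, hg⟩, fun z => rfl⟩

lemma H2 {n : ℕ} {r : ℝ} (hr : 0 < r) (h : HA n r) : ∃ g : (Fin n → ℂ) → ℂ, AnalyticAt ℂ g 0 ∧
    ∀ᶠ z in 𝓝 (0 : Fin n → ℂ), ∀ hz : z ∈ KB n r, h.1 ⟨z, hz⟩ = g z := by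
  obtain ⟨δ, hδ, k, hk1, hk2⟩ := FL hr 0 (crd n r) (fun i j => if i = j then 1 else 0) (by
    intro i; simp)
  refine ⟨k 0 h, hk1 0 h 0 (Metric.mem_ball_self hδ), ?_⟩
  filter_upwards [Metric.ball_mem_nhds 0 hδ] with z hz hz'
  have := hk2 h ⟨z, hz'⟩ hz
  rw [this]
  rw [Fintype.sum_eq_single 0]
  · have : (mon n r (N := 0) 0) = 1 := by simp [mon]
    rw [this]
    exact mul_one _
  · intro α hα
    exact absurd (funext fun i => Subsingleton.elim (α := Fin 1) _ _) hα

/-! germs -/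
section germs
variable {n m : ℕ}

lemma germ_rep {a : Fin n → ℂ} (g : AnalyticGermRingAt a) : ∃ f hf, g = analyticGermAt a f hf := by
  obtain ⟨g, f, hf, rfl⟩ := g
  exact ⟨f, hf, rfl⟩

lemma germ_eq {a : Fin n → ℂ} {f g hf hg} :
    analyticGermAt a f hf = analyticGermAt a g hg ↔ f =ᶠ[𝓝 a] g := by
  refine Subtype.ext_iff.trans ?_
  exact Filter.Germ.coe_eq

lemma germ_add {a : Fin n → ℂ} {f g : (Fin n → ℂ) → ℂ} (hf hg) :
    analyticGermAt a f hf + analyticGermAt a g hg = analyticGermAt a (fun z => f z + g z) (hf.add hg) := rfl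
lemma germ_sub {a : Fin n → ℂ} {f g : (Fin n → ℂ) → ℂ} (hf hg) :
    analyticGermAt a f hf - analyticGermAt a g hg = analyticGermAt a (fun z => f z - g z) (hf.sub hg) := rfl
lemma germ_mul {a : Fin n → ℂ} {f g : (Fin n → ℂ) → ℂ} (hf hg) :
    analyticGermAt a f hf * analyticGermAt a g hg = analyticGermAt a (fun z => f z * g z) (hf.mul hg) := rfl
lemma germ_zero {a : Fin n → ℂ} : (0 : AnalyticGermRingAt a) = analyticGermAt a (fun _ => 0) analyticAt_const := rfl
lemma germ_one {a : Fin n → ℂ} : (1 : AnalyticGermRingAt a) = analyticGermAt a (fun _ => 1) analyticAt_const := rfl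

/-- pullback of germs -/
noncomputable def pull (a : Fin n → ℂ) (b : Fin m → ℂ) (φ : (Fin n → ℂ) → (Fin m → ℂ)) (hφ : AnalyticAt ℂ φ a)
    (hab : φ a = b) : AnalyticGermRingAt b →+* AnalyticGermRingAt a where
  toFun g := ⟨g.1.compTendsto φ (by rw [← hab]; exact hφ.continuousAt), by
    obtain ⟨g, f, hf, rfl⟩ := g
    subst hab
    exact ⟨f ∘ φ, hf.comp hφ, rfl⟩⟩
  map_zero' := rfl
  map_one' := rfl
  map_add' := by
    intro x y
    obtain ⟨_, f, hf, rfl⟩ := x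
    obtain ⟨_, g, hg, rfl⟩ := y
    rfl
  map_mul' := by
    intro x y
    obtain ⟨_, f, hf, rfl⟩ := x
    obtain ⟨_, g, hg, rfl⟩ := y
    rfl

lemma pull_germ {a : Fin n → ℂ} {b : Fin m → ℂ} {φ} (hφ hab) {f} (hf : AnalyticAt ℂ f b) :
    pull a b φ hφ hab (analyticGermAt b f hf) =
      analyticGermAt a (fun z => f (φ z)) (AnalyticAt.fun_comp (by rw [hab]; exact hf) hφ) := rfl

/-- constants -/
noncomputable def cst (a : Fin n → ℂ) : ℂ →+* AnalyticGermRingAt a where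
  toFun c := analyticGermAt a (fun _ => c) analyticAt_const
  map_zero' := rfl
  map_one' := rfl
  map_add' _ _ := rfl
  map_mul' _ _ := rfl

noncomputable abbrev RR (n : ℕ) := AnalyticGermRingAt (0 : Fin n → ℂ)

lemma germ_isUnit {a : Fin n → ℂ} {f hf} (h : f a ≠ 0) : IsUnit (analyticGermAt a f hf) := by
  refine IsUnit.of_mul_eq_one (analyticGermAt a (fun z => (f z)⁻¹) (hf.inv h)) ?_
  rw [germ_mul, germ_one, germ_eq]
  filter_upwards [hf.continuousAt.eventually_ne h] with z hz
  exact mul_inv_cancel₀ hz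

/-- evaluation -/
noncomputable def evg (a : Fin n → ℂ) : AnalyticGermRingAt a →+* ℂ where
  toFun g := (Filter.Germ.value g.1)
  map_zero' := rfl
  map_one' := rfl
  map_add' := by
    intro x y
    obtain ⟨_, f, hf, rfl⟩ := x
    obtain ⟨_, g, hg, rfl⟩ := y
    rfl
  map_mul' := by
    intro x y
    obtain ⟨_, f, hf, rfl⟩ := x
    obtain ⟨_, g, hg, rfl⟩ := y
    rfl

lemma evg_germ {a : Fin n → ℂ} {f hf} : evg a (analyticGermAt a f hf) = f a := rfl

lemma germ_isUnit_iff {a : Fin n → ℂ} (g : AnalyticGermRingAt a) : IsUnit g ↔ evg a g ≠ 0 := by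
  constructor
  · intro h
    exact (h.map (evg a)).ne_zero
  · obtain ⟨f, hf, rfl⟩ := germ_rep g
    exact germ_isUnit

instance germ_nontriv (a : Fin n → ℂ) : Nontrivial (AnalyticGermRingAt a) := (evg a).domain_nontrivial

instance germ_local (a : Fin n → ℂ) : IsLocalRing (AnalyticGermRingAt a) := by
  apply IsLocalRing.of_nonunits_add
  intro x y hx hy
  simp only [mem_nonunits_iff, germ_isUnit_iff, not_not] at *
  rw [map_add, hx, hy, add_zero]

instance germ_domain (a : Fin n → ℂ) : IsDomain (AnalyticGermRingAt a) := by
  have : NoZeroDivisors (AnalyticGermRingAt a) := by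
    refine ⟨fun {x y} hxy => ?_⟩
    obtain ⟨f, hf, rfl⟩ := germ_rep x
    obtain ⟨g, hg, rfl⟩ := germ_rep y
    by_contra! hcon
    rw [germ_zero, germ_mul, germ_eq] at hxy
    obtain ⟨ε, hε, hball⟩ := Metric.mem_nhds_iff.1
      ((hf.eventually_analyticAt.and hg.eventually_analyticAt).and hxy)
    have hpre := (convex_ball a ε).isPreconnected
    have hfb : AnalyticOnNhd ℂ f (Metric.ball a ε) := fun z hz => (hball hz).1.1
    have hgb : AnalyticOnNhd ℂ g (Metric.ball a ε) := fun z hz => (hball hz).1.2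
    -- some point where f ≠ 0
    by_cases hex : ∃ z ∈ Metric.ball a ε, f z ≠ 0
    · obtain ⟨z, hz, hfz⟩ := hex
      have : g =ᶠ[𝓝 z] 0 := by
        filter_upwards [(hfb z hz).continuousAt.eventually_ne hfz,
          Metric.isOpen_ball.mem_nhds hz] with w hw hw2
        exact (mul_eq_zero.1 (hball hw2).2).resolve_left hw
      have := hgb.eqOn_zero_of_preconnected_of_eventuallyEq_zero hpre hz this
      apply hcon.2
      rw [germ_zero, germ_eq]
      filter_upwards [Metric.ball_mem_nhds a hε] with w hw
      exact this hw
    · push Not at hex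
      apply hcon.1
      rw [germ_zero, germ_eq]
      filter_upwards [Metric.ball_mem_nhds a hε] with w hw
      exact hex w hw
  exact NoZeroDivisors.to_isDomain _

end germs


section
variable {n m q : ℕ}

lemma zi_an (i : Fin n) (a : Fin n → ℂ) : AnalyticAt ℂ (fun z : Fin n → ℂ => z i) a :=
  (ContinuousLinearMap.proj (R := ℂ) (φ := fun _ : Fin n => ℂ) i).analyticAt a

lemma zp_an (i : Fin n) (k : ℕ) (a : Fin n → ℂ) : AnalyticAt ℂ (fun z : Fin n → ℂ => z i ^ k) a :=
  (zi_an i a).pow k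

noncomputable def zg (i : Fin n) : RR n :=
  analyticGermAt 0 (fun z => z i) (zi_an i 0)

lemma pi_analytic {φ : (Fin n → ℂ) → (Fin m → ℂ)} {a} (h : ∀ j, AnalyticAt ℂ (fun z => φ z j) a) :
    AnalyticAt ℂ φ a := AnalyticAt.pi h

lemma comp_analytic {φ : (Fin n → ℂ) → (Fin m → ℂ)} {a} (h : AnalyticAt ℂ φ a) (j) :
    AnalyticAt ℂ (fun z => φ z j) a := analyticAt_pi_iff.1 h j

lemma upd_analytic (i : Fin n) (a : Fin n → ℂ) : AnalyticAt ℂ (fun z : Fin n → ℂ => Function.update z i 0) a := by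
  apply pi_analytic
  intro j
  by_cases h : j = i
  · subst h; simpa using analyticAt_const
  · simpa [h] using zi_an j a

lemma setup {φ : (Fin n → ℂ) → (Fin q → ℂ)} (hφ : AnalyticAt ℂ φ 0) (hφ0 : φ 0 = 0) (N : ℕ)
    (h : ∀ i, (zg i : RR n) ^ (N+1) ∈ Ideal.span (Set.range fun j => pull 0 0 φ hφ hφ0 (zg j))) :
    ∀ᶠ r in 𝓝[>] (0:ℝ), ∃ (F : Fin q → HA n r) (a : Fin n → Fin q → HA n r),
      (∀ j z, (F j).1 z = φ z.1 j) ∧ ∀ i, crd n r i ^ (N + 1) = ∑ j, a i j * F j := by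
  have h1 : ∀ i, ∃ a : Fin q → (Fin n → ℂ) → ℂ, (∀ j, AnalyticAt ℂ (a j) 0) ∧
      ∀ᶠ z in 𝓝 (0 : Fin n → ℂ), z i ^ (N + 1) = ∑ j, a j z * φ z j := by
    intro i
    obtain ⟨c, hc⟩ := Ideal.mem_span_range_iff_exists_fun.1 (h i)
    choose a ha hca using fun j => germ_rep (c j)
    refine ⟨a, ha, ?_⟩
    have e : ∑ j, c j * pull 0 0 φ hφ hφ0 (zg j) =
        analyticGermAt 0 (fun z => ∑ j, a j z * φ z j)
          (Finset.analyticAt_fun_sum _ fun j _ => (ha j).mul (comp_analytic hφ j)) := by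
      refine Subtype.ext ?_
      rw [AddSubmonoidClass.coe_finsetSum]
      have := map_sum (Filter.Germ.coeRingHom (R := ℂ) (𝓝 (0 : Fin n → ℂ)))
        (fun j z => a j z * φ z j) Finset.univ
      have e2 : (fun z => ∑ j, a j z * φ z j) = ∑ j, fun z => a j z * φ z j := by
        funext z; simp
      change _ = (Filter.Germ.coeRingHom (R := ℂ) (𝓝 (0 : Fin n → ℂ))) _
      rw [e2, this]
      refine Finset.sum_congr rfl fun j _ => ?_
      rw [hca j]
      rfl
    have e3 : (zg i : RR n) ^ (N + 1) = analyticGermAt 0 (fun z => z i ^ (N+1))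
      (zp_an i (N+1) 0) := rfl
    rw [e, e3, germ_eq] at hc
    exact hc.symm
  choose a ha hae using h1
  have hF : ∀ᶠ r in 𝓝[>] (0:ℝ), ∀ j, ∃ g : HA n r, ∀ z : KB n r, g.1 z = φ z.1 j :=
    eventually_all.2 fun j => H1 (comp_analytic hφ j)
  have hA : ∀ᶠ r in 𝓝[>] (0:ℝ), ∀ i j, ∃ g : HA n r, ∀ z : KB n r, g.1 z = a i j z.1 :=
    eventually_all.2 fun i => eventually_all.2 fun j => H1 (ha i j)
  obtain ⟨ε, hε, hball⟩ := Metric.mem_nhds_iff.1 (eventually_all.2 hae)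
  filter_upwards [hF, hA, Ioo_mem_nhdsGT hε] with r hF hA hr
  choose F hF using hF
  choose A hA using hA
  refine ⟨F, A, hF, fun i => ?_⟩
  refine Subtype.ext (ContinuousMap.ext fun z => ?_)
  let ev : HA n r →ₐ[ℂ] ℂ := (ContinuousMap.evalAlgHom ℂ ℂ z).comp (HA n r).val
  change ev (crd n r i ^ (N + 1)) = ev (∑ j, A i j * F j)
  rw [map_pow, map_sum]
  simp only [map_mul]
  have := hball (Metric.closedBall_subset_ball hr.2 z.2) i
  refine this.trans (Finset.sum_congr rfl fun j _ => ?_)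
  change _ = (A i j).1 z * (F j).1 z
  rw [hA, hF]

lemma sum_germ {a : Fin n → ℂ} {ι : Type*} (s : Finset ι) (f : ι → (Fin n → ℂ) → ℂ) (hf : ∀ i, AnalyticAt ℂ (f i) a) :
    ∑ i ∈ s, analyticGermAt a (f i) (hf i) = analyticGermAt a (fun z => ∑ i ∈ s, f i z)
      (Finset.analyticAt_fun_sum _ fun j _ => hf j) := by
  classical
  induction s using Finset.induction_on with
  | empty => rfl
  | insert i s hi ih =>
    rw [Finset.sum_insert hi, ih, germ_add, germ_eq]
    exact Eventually.of_forall fun z => (Finset.sum_insert (f := fun i => f i z) hi).symm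

lemma prod_germ {a : Fin n → ℂ} {ι : Type*} (s : Finset ι) (f : ι → (Fin n → ℂ) → ℂ) (hf : ∀ i, AnalyticAt ℂ (f i) a) :
    ∏ i ∈ s, analyticGermAt a (f i) (hf i) = analyticGermAt a (fun z => ∏ i ∈ s, f i z)
      (Finset.analyticAt_fun_prod _ fun j _ => hf j) := by
  classical
  induction s using Finset.induction_on with
  | empty => rfl
  | insert i s hi ih =>
    rw [Finset.prod_insert hi, ih, germ_mul, germ_eq]
    exact Eventually.of_forall fun z => (Finset.prod_insert (f := fun i => f i z) hi).symm

lemma mon_val {r : ℝ} {N : ℕ} (α : Fin n → Fin (N+1)) (z : KB n r) :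
    (mon n r α).1 z = ∏ i, z.1 i ^ (α i : ℕ) := by
  let ev : HA n r →ₐ[ℂ] ℂ := (ContinuousMap.evalAlgHom ℂ ℂ z).comp (HA n r).val
  change ev _ = _
  rw [mon, map_prod]
  refine Finset.prod_congr rfl fun i _ => ?_
  rw [map_pow]; rfl

lemma FLgerm {φ : (Fin n → ℂ) → (Fin q → ℂ)} (hφ : AnalyticAt ℂ φ 0) (hφ0 : φ 0 = 0)
    (h : ∀ i, ∃ N, (zg i : RR n) ^ N ∈ Ideal.span (Set.range fun j => pull 0 0 φ hφ hφ0 (zg j))) :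
    (pull 0 0 φ hφ hφ0).IsIntegral := by
  choose M hM using h
  let N := Finset.univ.sup M
  have hN : ∀ i, (zg i : RR n) ^ (N+1) ∈ Ideal.span (Set.range fun j => pull 0 0 φ hφ hφ0 (zg j)) := by
    intro i
    have : M i ≤ N + 1 := (Finset.le_sup (f := M) (Finset.mem_univ i)).trans (Nat.le_succ _)
    exact Ideal.mem_of_dvd _ (pow_dvd_pow _ this) (hM i)
  have hs := setup hφ hφ0 N hN
  classical
  apply RingHom.Finite.to_isIntegral
  let _ : Algebra (RR q) (RR n) := (pull 0 0 φ hφ hφ0).toAlgebra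
  change Module.Finite (RR q) (RR n)
  refine ⟨⟨Finset.univ.image fun α : Fin n → Fin (N+1) => ∏ i, (zg i : RR n) ^ (α i : ℕ), ?_⟩⟩
  rw [eq_top_iff]
  intro x _
  obtain ⟨f, hf, rfl⟩ := germ_rep x
  obtain ⟨r, ⟨⟨F, a, hF, ha⟩, g, hg⟩, hr⟩ := ((hs.and (H1 hf)).and self_mem_nhdsWithin).exists
  obtain ⟨δ, hδ, k, hk1, hk2⟩ := FL hr N F a ha
  have hk0 : ∀ α, AnalyticAt ℂ (k α g) 0 := fun α => hk1 α g 0 (Metric.mem_ball_self hδ)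
  have key : analyticGermAt 0 f hf = ∑ α : Fin n → Fin (N+1),
      (analyticGermAt 0 (k α g) (hk0 α)) • ∏ i, (zg i : RR n) ^ (α i : ℕ) := by
    have e : ∀ α : Fin n → Fin (N+1),
      (analyticGermAt 0 (k α g) (hk0 α)) • ∏ i, (zg i : RR n) ^ (α i : ℕ) =
      analyticGermAt 0 (fun z => k α g (φ z) * ∏ i, z i ^ (α i : ℕ))
        ((AnalyticAt.fun_comp (by rw [hφ0]; exact hk0 α) hφ).mul (Finset.analyticAt_fun_prod _ fun j _ =>
          zp_an j _ 0)) := by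
      intro α
      rw [Algebra.smul_def]
      have : ∏ i, (zg i : RR n) ^ (α i : ℕ) = _ := prod_germ (a := 0) Finset.univ (fun i z => z i ^ (α i : ℕ))
        (fun j => zp_an j _ 0)
      rw [this]
      rfl
    simp_rw [e]
    rw [sum_germ, germ_eq]
    have hcont : ∀ᶠ z in 𝓝 (0 : Fin n → ℂ), φ z ∈ Metric.ball (0 : Fin q → ℂ) δ := by
      apply hφ.continuousAt
      rw [hφ0]
      exact Metric.ball_mem_nhds _ hδ
    filter_upwards [hcont, Metric.closedBall_mem_nhds (0 : Fin n → ℂ) hr] with z hz hzr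
    have hFz : (fun j => (F j).1 ⟨z, hzr⟩) = φ z := by funext j; exact hF j ⟨z, hzr⟩
    have := hk2 g ⟨z, hzr⟩ (by rw [hFz]; exact hz)
    rw [hg, hFz] at this
    rw [this]
    refine Finset.sum_congr rfl fun α _ => ?_
    rw [mon_val]
  rw [key]
  refine Submodule.sum_mem _ fun α _ => Submodule.smul_mem _ _ (Submodule.subset_span ?_)
  simp

lemma had (i : Fin n) (x : RR n) : ∃ y, x = pull 0 0 (fun z => Function.update z i 0) (upd_analytic i 0)
    (by simp) x + zg i * y := by
  obtain ⟨f, hf, rfl⟩ := germ_rep x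
  obtain ⟨r, ⟨g, hg⟩, hr⟩ := ((H1 hf).and self_mem_nhdsWithin).exists
  obtain ⟨D, hD⟩ := exists_DH hr i
  obtain ⟨y, hy, hy2⟩ := H2 hr (D g)
  refine ⟨analyticGermAt 0 y hy, ?_⟩
  rw [pull_germ, zg, germ_mul, germ_add, germ_eq]
  filter_upwards [hy2, Metric.closedBall_mem_nhds (0 : Fin n → ℂ) hr] with z hz hzr
  have e := hD g
  have e2 : g.1 ⟨z, hzr⟩ = (EH n r i g).1 ⟨z, hzr⟩ + z i * (D g).1 ⟨z, hzr⟩ := by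
    conv_lhs => rw [e]
    rfl
  rw [hz, hg] at e2
  rw [e2]
  congr 1
  exact hg _

lemma pull_comp {k : ℕ} {a : Fin n → ℂ} {b : Fin m → ℂ} {c : Fin k → ℂ} {φ ψ} (hφ hab) (hψ hbc) (h1 h2)
    (x : AnalyticGermRingAt c) :
    pull a b φ hφ hab (pull b c ψ hψ hbc x) = pull a c (fun z => ψ (φ z)) h1 h2 x := by
  obtain ⟨f, hf, rfl⟩ := germ_rep x
  rfl

lemma pull_id {a : Fin n → ℂ} (h1 h2) (x : AnalyticGermRingAt a) :
    pull a a (fun z => z) h1 h2 x = x := by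
  obtain ⟨f, hf, rfl⟩ := germ_rep x
  rfl

lemma pull_congr {a : Fin n → ℂ} {b : Fin m → ℂ} {φ ψ : (Fin n → ℂ) → Fin m → ℂ} (hφ hab) (hψ hbc)
    (h : φ = ψ) (x : AnalyticGermRingAt b) :
    pull a b φ hφ hab x = pull a b ψ hψ hbc x := by
  subst h; rfl

lemma had' (i : Fin n) (x : RR n) : x - pull 0 0 (fun z => Function.update z i 0) (upd_analytic i 0)
    (by simp) x ∈ Ideal.span {zg i} := by
  obtain ⟨y, hy⟩ := had i x
  rw [Ideal.mem_span_singleton]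
  exact ⟨y, by rw [sub_eq_iff_eq_add']; exact hy⟩

lemma max_ideal (x : RR n) (hx : evg 0 x = 0) : x ∈ Ideal.span (Set.range (zg (n := n))) := by
  have key : ∀ s : Finset (Fin n), ∃ (φ : (Fin n → ℂ) → (Fin n → ℂ)) (hφ : AnalyticAt ℂ φ 0) (hφ0 : φ 0 = 0),
      (∀ z i, φ z i = if i ∈ s then 0 else z i) ∧ x - pull 0 0 φ hφ hφ0 x ∈ Ideal.span (Set.range (zg (n := n))) := by
    intro s
    induction s using Finset.induction_on with
    | empty =>
      refine ⟨fun z => z, analyticAt_id, rfl, by simp, ?_⟩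
      rw [pull_id, sub_self]
      exact zero_mem _
    | insert i s hi ih =>
      obtain ⟨φ, hφ, hφ0, h1, h2⟩ := ih
      have h3 := had' i (pull 0 0 φ hφ hφ0 x)
      have hA0 : (fun z => φ (Function.update z i 0)) 0 = 0 := by simp [hφ0]
      have hA : AnalyticAt ℂ (fun z => φ (Function.update z i 0)) 0 :=
        AnalyticAt.fun_comp (g := φ) (by simpa using hφ) (upd_analytic i _)
      refine ⟨fun z => φ (Function.update z i 0), hA, hA0, ?_, ?_⟩
      · intro z j
        dsimp only
        rw [h1]
        by_cases hjs : j ∈ s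
        · simp [hjs]
        · by_cases hji : j = i
          · subst hji; simp
          · simp [hjs, hji]
      · rw [pull_comp _ _ _ _ hA hA0] at h3
        have h4 := Ideal.add_mem _ h2 (Ideal.span_mono (by simp) h3)
        simpa using h4
  obtain ⟨φ, hφ, hφ0, h1, h2⟩ := key Finset.univ
  have h3 : φ = fun _ => 0 := by funext z i; simp [h1]
  subst h3
  have : pull 0 0 (fun _ => 0) hφ hφ0 x = 0 := by
    obtain ⟨f, hf, rfl⟩ := germ_rep x
    rw [evg_germ] at hx
    rw [pull_germ, germ_zero, germ_eq]
    exact Eventually.of_forall fun _ => hx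
  rwa [this, sub_zero] at h2

lemma init_an (a : Fin (n+1) → ℂ) : AnalyticAt ℂ (fun z : Fin (n+1) → ℂ => (Fin.init z : Fin n → ℂ)) a :=
  pi_analytic fun j => zi_an _ _

lemma init_zero : (Fin.init (0 : Fin (n+1) → ℂ) : Fin n → ℂ) = 0 := rfl

lemma snoc_an (a : Fin n → ℂ) : AnalyticAt ℂ (fun z : Fin n → ℂ => (Fin.snoc z (0:ℂ) : Fin (n+1) → ℂ)) a := by
  apply pi_analytic
  intro j
  induction j using Fin.lastCases with
  | last => simpa using analyticAt_const
  | cast j => simpa using zi_an j a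

lemma snoc_zero : (Fin.snoc (0 : Fin n → ℂ) (0:ℂ) : Fin (n+1) → ℂ) = 0 := by
  funext j
  induction j using Fin.lastCases with
  | last => simp
  | cast j => simp

/-- restriction to last coordinate zero -/
noncomputable def rst (n : ℕ) : RR (n+1) →+* RR n := pull 0 0 (fun z => (Fin.snoc z (0:ℂ) : Fin (n+1) → ℂ))
  (snoc_an 0) snoc_zero

noncomputable def incl (n : ℕ) : RR n →+* RR (n+1) := pull 0 0 (fun z => (Fin.init z : Fin n → ℂ))
  (init_an 0) init_zero

lemma rst_incl (x : RR n) : rst n (incl n x) = x := by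
  obtain ⟨f, hf, rfl⟩ := germ_rep x
  rw [rst, incl, pull_germ, pull_germ, germ_eq]
  refine Eventually.of_forall fun z => ?_
  simp

lemma rst_surj : Function.Surjective (rst n) := fun x => ⟨_, rst_incl x⟩

lemma rst_last : rst n (zg (Fin.last n)) = 0 := by
  rw [rst, zg, pull_germ, germ_zero, germ_eq]
  refine Eventually.of_forall fun z => ?_
  simp

lemma sub_incl_rst (x : RR (n+1)) : x - incl n (rst n x) ∈ Ideal.span {zg (Fin.last n)} := by
  convert had' (Fin.last n) x using 2
  obtain ⟨f, hf, rfl⟩ := germ_rep x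
  rw [rst, incl, pull_germ, pull_germ, pull_germ, germ_eq]
  refine Eventually.of_forall fun z => ?_
  dsimp only
  congr 1
  funext j
  induction j using Fin.lastCases with
  | last => simp
  | cast j => simp [Fin.init]

lemma rst_ker (x : RR (n+1)) (h : rst n x = 0) : x ∈ Ideal.span {zg (Fin.last n)} := by
  have := sub_incl_rst x
  rwa [h, map_zero, sub_zero] at this

end


section alg
universe u v
variable {R : Type u} {S : Type v} [CommRing R] [CommRing S]

lemma dim_le_of_integral (f : R →+* S) (hf : f.IsIntegral) : ringKrullDim S ≤ ringKrullDim R := by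
  let _ : Algebra R S := f.toAlgebra
  have : Algebra.IsIntegral R S := ⟨hf⟩
  refine Order.krullDim_le_of_strictMono (PrimeSpectrum.comap (algebraMap R S)) ?_
  intro P Q hPQ
  exact Ideal.IsIntegral.comap_lt_comap (R := R) (I := P.asIdeal) (J := Q.asIdeal) hPQ

lemma dim_ge_of_integral (f : R →+* S) (hf : f.IsIntegral) (hinj : Function.Injective f) :
    ringKrullDim R ≤ ringKrullDim S := by
  let _ : Algebra R S := f.toAlgebra
  have : Algebra.IsIntegral R S := ⟨hf⟩
  refine iSup_le fun l => ?_
  obtain ⟨P, _, hP, hP2⟩ := Ideal.exists_ideal_over_prime_of_isIntegral (S := S) l.head.asIdeal ⊥ (by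
    have : Ideal.comap (algebraMap R S) ⊥ = ⊥ := by
      rw [← RingHom.ker_eq_comap_bot]; exact (RingHom.injective_iff_ker_eq_bot _).1 hinj
    rw [this]; exact bot_le)
  have : P.LiesOver l.head.asIdeal := ⟨hP2.symm⟩
  obtain ⟨L, hL, _⟩ := Ideal.exists_ltSeries_of_hasGoingUp (S := S) l P
  rw [← hL]
  exact le_iSup (fun L : LTSeries (PrimeSpectrum S) => (L.length : WithBot ℕ∞)) L

lemma dim_le_succ [IsDomain R] (m : ℕ)
    (h : ∀ f : R, f ≠ 0 → ringKrullDim (R ⧸ Ideal.span {f}) ≤ m) :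
    ringKrullDim R ≤ (m + 1 : ℕ) := by
  refine iSup_le fun l => ?_
  rcases Nat.eq_zero_or_pos l.length with h0 | h0
  · rw [h0]; exact_mod_cast Nat.zero_le _
  obtain ⟨k, hk⟩ : ∃ k, l.length = k + 1 := ⟨l.length - 1, by omega⟩
  have hlt : l ⟨0, by omega⟩ < l ⟨1, by omega⟩ := l.strictMono (by simp [Fin.lt_def])
  obtain ⟨_, f, hf1, hf0⟩ := SetLike.lt_iff_le_and_exists.1 (show (l ⟨0, by omega⟩).asIdeal < (l ⟨1, by omega⟩).asIdeal from hlt)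
  have hf : f ≠ 0 := by rintro rfl; exact hf0 (zero_mem _)
  have hd := h f hf
  rw [ringKrullDim_quotient] at hd
  let L : LTSeries (PrimeSpectrum.zeroLocus (R := R) (Ideal.span {f})) :=
    { length := k
      toFun := fun i => ⟨l ⟨i.1 + 1, by omega⟩, by
        rw [PrimeSpectrum.zeroLocus_span, PrimeSpectrum.mem_zeroLocus, Set.singleton_subset_iff]
        have : l ⟨1, by omega⟩ ≤ l ⟨i.1 + 1, by omega⟩ := l.monotone (by simp [Fin.le_def])
        exact this hf1⟩
      step := fun i => by
        have : l ⟨i.1 + 1, by omega⟩ < l ⟨i.1 + 1 + 1, by omega⟩ := l.strictMono (by simp [Fin.lt_def])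
        exact this }
  have h2 : ((k : ℕ) : WithBot ℕ∞) ≤ Order.krullDim _ :=
    le_iSup (fun L : LTSeries (PrimeSpectrum.zeroLocus (R := R) (Ideal.span {f})) => (L.length : WithBot ℕ∞)) L
  have h3 := h2.trans hd
  have h4 : k ≤ m := by exact_mod_cast h3
  rw [hk]
  exact_mod_cast Nat.succ_le_succ h4

end alg

section W
variable {n : ℕ}

lemma had_s (s : Finset (Fin n)) (x : RR n) :
    ∃ (φ : (Fin n → ℂ) → (Fin n → ℂ)) (hφ : AnalyticAt ℂ φ 0) (hφ0 : φ 0 = 0),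
      (∀ z i, φ z i = if i ∈ s then 0 else z i) ∧ x - pull 0 0 φ hφ hφ0 x ∈ Ideal.span ((zg (n := n)) '' s) := by
  induction s using Finset.induction_on with
  | empty =>
    refine ⟨fun z => z, analyticAt_id, rfl, by simp, ?_⟩
    rw [pull_id, sub_self]
    exact zero_mem _
  | insert i s hi ih =>
    obtain ⟨φ, hφ, hφ0, h1, h2⟩ := ih
    have h3 := had' i (pull 0 0 φ hφ hφ0 x)
    have hA0 : (fun z => φ (Function.update z i 0)) 0 = 0 := by simp [hφ0]
    have hA : AnalyticAt ℂ (fun z => φ (Function.update z i 0)) 0 :=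
      AnalyticAt.fun_comp (g := φ) (by simpa using hφ) (upd_analytic i _)
    refine ⟨fun z => φ (Function.update z i 0), hA, hA0, ?_, ?_⟩
    · intro z j
      dsimp only
      rw [h1]
      by_cases hjs : j ∈ s
      · simp [hjs]
      · by_cases hji : j = i
        · subst hji; simp
        · simp [hjs, hji]
    · rw [pull_comp _ _ _ _ hA hA0] at h3
      have h4 := Ideal.add_mem (Ideal.span ((zg (n := n)) '' (insert i s : Finset (Fin n))))
        (Ideal.span_mono (Set.image_mono (by simp)) h2) (Ideal.span_mono (by simp) h3)
      simpa using h4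

/-- Weierstrass-type finiteness, in good coordinates. -/
lemma W_good (f : (Fin (n+1) → ℂ) → ℂ) (hf : AnalyticAt ℂ f 0) (hf0 : f 0 = 0)
    (hreg : ¬ ∀ᶠ t in 𝓝 (0:ℂ), f (Pi.single (Fin.last n) t) = 0) :
    ((Ideal.Quotient.mk (Ideal.span {analyticGermAt 0 f hf})).comp (incl n)).IsIntegral := by
  set fg := analyticGermAt 0 f hf with hfg
  let θ : (Fin (n+1) → ℂ) → (Fin (n+1) → ℂ) := fun z => Fin.snoc (Fin.init z) (f z)
  have hθ : AnalyticAt ℂ θ 0 := by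
    apply pi_analytic
    intro j
    induction j using Fin.lastCases with
    | last => simpa [θ] using hf
    | cast j => simpa [θ, Fin.init] using zi_an j.castSucc 0
  have hθ0 : θ 0 = 0 := by
    simp only [θ, hf0, init_zero, snoc_zero]
  have e1 : ∀ j : Fin n, pull 0 0 θ hθ hθ0 (zg j.castSucc) = zg j.castSucc := by
    intro j
    rw [zg, pull_germ, germ_eq]
    exact Eventually.of_forall fun z => by simp [θ, Fin.init]
  have e2 : pull 0 0 θ hθ hθ0 (zg (Fin.last n)) = fg := by
    rw [zg, pull_germ, germ_eq]
    exact Eventually.of_forall fun z => by simp [θ]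
  have hInt : (pull 0 0 θ hθ hθ0).IsIntegral := by
    apply FLgerm
    set J := Ideal.span (Set.range fun j => pull 0 0 θ hθ hθ0 (zg j)) with hJ
    have hJ1 : ∀ j : Fin n, zg j.castSucc ∈ J := fun j => by
      rw [← e1]; exact Ideal.subset_span ⟨_, rfl⟩
    have hJ2 : fg ∈ J := by rw [← e2]; exact Ideal.subset_span ⟨_, rfl⟩
    intro i
    induction i using Fin.lastCases with
    | cast j => exact ⟨1, by rw [pow_one]; exact hJ1 j⟩
    | last =>
      obtain ⟨φ, hφ, hφ0, h1, h2⟩ := had_s (Finset.univ.erase (Fin.last n)) fg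
      have h3 : pull 0 0 φ hφ hφ0 fg ∈ J := by
        have : Ideal.span ((zg (n := n+1)) '' (Finset.univ.erase (Fin.last n) : Finset (Fin (n+1)))) ≤ J := by
          rw [Ideal.span_le]
          rintro _ ⟨i, hi, rfl⟩
          induction i using Fin.lastCases with
          | last => simp at hi
          | cast j => exact hJ1 j
        have := J.sub_mem hJ2 (this h2)
        simpa using this
      have hφ1 : φ = fun z => Pi.single (Fin.last n) (z (Fin.last n)) := by
        funext z i
        rw [h1]
        by_cases hi : i = Fin.last n
        · subst hi; simp
        · simp [hi]
      have hsing : AnalyticAt ℂ (fun t : ℂ => (Pi.single (Fin.last n) t : Fin (n+1) → ℂ)) 0 := by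
        exact (ContinuousLinearMap.single ℂ (fun _ : Fin (n+1) => ℂ) (Fin.last n)).analyticAt 0
      have hg : AnalyticAt ℂ (fun t : ℂ => f (Pi.single (Fin.last n) t)) 0 :=
        AnalyticAt.fun_comp (g := f) (by simpa using hf) hsing
      obtain ⟨N, u, hu, hu0, hgu⟩ := hg.exists_eventuallyEq_pow_smul_nonzero_iff.2 hreg
      have hu' : AnalyticAt ℂ (fun z : Fin (n+1) → ℂ => u (z (Fin.last n))) 0 :=
        AnalyticAt.fun_comp (g := u) hu (zi_an _ 0)
      refine ⟨N, ?_⟩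
      have h4 : pull 0 0 φ hφ hφ0 fg = zg (Fin.last n) ^ N * analyticGermAt 0 _ hu' := by
        have : (zg (Fin.last n) : RR (n+1)) ^ N = analyticGermAt 0 (fun z => z (Fin.last n) ^ N)
          (zp_an _ N 0) := rfl
        rw [hfg, pull_germ, this, germ_mul, germ_eq]
        have hc : Tendsto (fun z : Fin (n+1) → ℂ => z (Fin.last n)) (𝓝 0) (𝓝 0) :=
          (continuous_apply (Fin.last n)).tendsto 0
        filter_upwards [hc.eventually hgu] with z hz
        rw [hφ1]
        simpa using hz
      rw [h4] at h3
      exact (Ideal.unit_mul_mem_iff_mem J (germ_isUnit hu0)).1 (by rwa [mul_comm])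
  have hcomp : (Ideal.Quotient.mk (Ideal.span {fg})).comp (pull 0 0 θ hθ hθ0) =
      ((Ideal.Quotient.mk (Ideal.span {fg})).comp (incl n)).comp (rst n) := by
    ext y
    simp only [RingHom.comp_apply]
    have h := Ideal.mem_map_of_mem (pull 0 0 θ hθ hθ0) (sub_incl_rst y)
    rw [Ideal.map_span, Set.image_singleton, e2, map_sub] at h
    rw [Ideal.Quotient.eq]
    convert h using 2
    obtain ⟨g, hg, hg2⟩ := germ_rep (rst n y)
    rw [hg2, incl, pull_germ, pull_germ, germ_eq]
    exact Eventually.of_forall fun z => by simp [θ]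
  have hI2 := RingHom.IsIntegral.trans _ _ hInt (RingHom.isIntegral_of_surjective _ (Ideal.Quotient.mk_surjective (I := Ideal.span {fg})))
  rw [hcomp] at hI2
  exact RingHom.IsIntegral.tower_top _ _ hI2

end W


section
variable {n : ℕ}

lemma exists_dir (f : (Fin n → ℂ) → ℂ) (hf : AnalyticAt ℂ f 0) (hne : ¬ ∀ᶠ z in 𝓝 0, f z = 0) :
    ∃ v : Fin n → ℂ, ¬ ∀ᶠ t in 𝓝 (0:ℂ), f (t • v) = 0 := by
  by_contra! hcon
  apply hne
  obtain ⟨ε, hε, hball⟩ := Metric.mem_nhds_iff.1 hf.eventually_analyticAt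
  filter_upwards [Metric.ball_mem_nhds 0 hε] with w hw
  let L : ℂ →L[ℂ] (Fin n → ℂ) := ContinuousLinearMap.toSpanSingleton ℂ w
  have hL : ∀ t, L t = t • w := fun t => by simp [L]
  have hA : AnalyticOnNhd ℂ (fun t => f (L t)) (L ⁻¹' Metric.ball 0 ε) := by
    intro t ht
    exact AnalyticAt.fun_comp (g := f) (hball ht) (L.analyticAt t)
  have hconv : Convex ℝ (L ⁻¹' Metric.ball (0 : Fin n → ℂ) ε) :=
    (convex_ball (0 : Fin n → ℂ) ε).linear_preimage (L.toLinearMap.restrictScalars ℝ)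
  have h0 : (0:ℂ) ∈ L ⁻¹' Metric.ball (0 : Fin n → ℂ) ε := by simp [hε]
  have h1 : (1:ℂ) ∈ L ⁻¹' Metric.ball (0 : Fin n → ℂ) ε := by
    change L 1 ∈ Metric.ball (0 : Fin n → ℂ) ε; rw [hL, one_smul]; exact hw
  have := hA.eqOn_zero_of_preconnected_of_eventuallyEq_zero hconv.isPreconnected h0 (by
    filter_upwards [hcon w] with t ht
    rw [hL]; exact ht) h1
  simpa [hL] using this

lemma W_gen (f : RR (n+1)) (hf0 : evg 0 f = 0) (hf : f ≠ 0) :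
    ∃ (ψ : (Fin (n+1) → ℂ) → (Fin n → ℂ)) (hψ : AnalyticAt ℂ ψ 0) (hψ0 : ψ 0 = 0),
    ((Ideal.Quotient.mk (Ideal.span {f})).comp (pull 0 0 ψ hψ hψ0)).IsIntegral := by
  obtain ⟨F, hF, rfl⟩ := germ_rep f
  rw [evg_germ] at hf0
  rw [Ne, germ_zero, germ_eq] at hf
  obtain ⟨v, hv⟩ := exists_dir F hF hf
  have hv0 : v ≠ 0 := by
    rintro rfl
    exact hv (Eventually.of_forall fun t => by simpa using hf0)
  obtain ⟨A, hA⟩ := SeparatingDual.exists_continuousLinearEquiv_apply_eq (R := ℂ)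
    (x := (Pi.single (Fin.last n) 1 : Fin (n+1) → ℂ)) (y := v) (by simp) hv0
  have hAan : ∀ a, AnalyticAt ℂ (fun z => A z) a := fun a => A.toContinuousLinearMap.analyticAt a
  have hBan : ∀ a, AnalyticAt ℂ (fun z => A.symm z) a := fun a => A.symm.toContinuousLinearMap.analyticAt a
  have hA0 : (fun z => A z) 0 = 0 := map_zero A
  have hB0 : (fun z => A.symm z) 0 = 0 := map_zero A.symm
  have hG : AnalyticAt ℂ (fun z => F (A z)) 0 := AnalyticAt.fun_comp (g := F) (by simpa using hF) (hAan 0)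
  have hW := W_good (fun z => F (A z)) hG (by simpa using hf0) (by
    convert hv using 4 with t
    rw [← hA, ← map_smul]
    congr 1
    rw [← Pi.single_smul]; simp)
  set J := Ideal.span {analyticGermAt 0 F hF}
  set J' := Ideal.span {analyticGermAt 0 _ hG} with hJ'
  let B := pull 0 0 (fun z => A.symm z) (hBan 0) hB0
  have hB : J' ≤ J.comap B := by
    rw [hJ', Ideal.span_le, Set.singleton_subset_iff]
    change B _ ∈ J
    have : B (analyticGermAt 0 _ hG) = analyticGermAt 0 F hF := by
      simp only [B]
      rw [pull_germ, germ_eq]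
      exact Eventually.of_forall fun z => by simp
    rw [this]
    exact Ideal.mem_span_singleton_self _
  have hBs : Function.Surjective B := by
    intro x
    refine ⟨pull 0 0 (fun z => A z) (hAan 0) hA0 x, ?_⟩
    obtain ⟨g, hg, rfl⟩ := germ_rep x
    simp only [B]
    rw [pull_germ, pull_germ, germ_eq]
    exact Eventually.of_forall fun z => by simp
  have hψ : AnalyticAt ℂ (fun z => (Fin.init (A.symm z) : Fin n → ℂ)) 0 :=
    AnalyticAt.fun_comp (g := fun z : Fin (n+1) → ℂ => (Fin.init z : Fin n → ℂ)) (init_an _) (hBan 0)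
  have hψ0 : (fun z => (Fin.init (A.symm z) : Fin n → ℂ)) 0 = 0 := by
    simp only [map_zero]; exact init_zero
  refine ⟨_, hψ, hψ0, ?_⟩
  have h2 := RingHom.IsIntegral.trans _ _ hW (RingHom.isIntegral_of_surjective (Ideal.quotientMap J B hB)
    (Ideal.quotientMap_surjective hBs))
  have e : (Ideal.Quotient.mk J).comp (pull 0 0 _ hψ hψ0) =
      (Ideal.quotientMap J B hB).comp ((Ideal.Quotient.mk J').comp (incl n)) := by
    refine RingHom.ext fun x => ?_
    simp only [RingHom.comp_apply, Ideal.quotientMap_mk, B, incl]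
    rw [pull_comp (hBan 0) hB0 (init_an 0) init_zero hψ hψ0]
  rw [e]
  exact h2

lemma NN : ∀ (n : ℕ) (I : Ideal (RR n)), I ≠ ⊤ →
    ∃ (d : ℕ) (φ : (Fin n → ℂ) → (Fin d → ℂ)) (hφ : AnalyticAt ℂ φ 0) (hφ0 : φ 0 = 0),
      ((Ideal.Quotient.mk I).comp (pull 0 0 φ hφ hφ0)).IsIntegral ∧
      Function.Injective ((Ideal.Quotient.mk I).comp (pull 0 0 φ hφ hφ0)) := by
  intro n
  induction n with
  | zero =>
    intro I hI
    have hbot : I = ⊥ := by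
      rw [eq_bot_iff]
      intro x hx
      have h0 : evg 0 x = 0 := by
        by_contra h
        exact hI (I.eq_top_of_isUnit_mem hx ((germ_isUnit_iff x).2 h))
      have := max_ideal x h0
      simpa using this
    subst hbot
    refine ⟨0, fun z => z, analyticAt_id, rfl, ?_, ?_⟩
    · apply RingHom.isIntegral_of_surjective
      intro y
      obtain ⟨x, rfl⟩ := Ideal.Quotient.mk_surjective y
      exact ⟨x, by simp [pull_id]⟩
    · intro x y h
      simp only [RingHom.comp_apply, pull_id] at h
      rw [Ideal.Quotient.eq, Ideal.mem_bot, sub_eq_zero] at h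
      exact h
  | succ m ih =>
    intro I hI
    by_cases hbot : I = ⊥
    · subst hbot
      refine ⟨m+1, fun z => z, analyticAt_id, rfl, ?_, ?_⟩
      · apply RingHom.isIntegral_of_surjective
        intro y
        obtain ⟨x, rfl⟩ := Ideal.Quotient.mk_surjective y
        exact ⟨x, by simp [pull_id]⟩
      · intro x y h
        simp only [RingHom.comp_apply, pull_id] at h
        rw [Ideal.Quotient.eq, Ideal.mem_bot, sub_eq_zero] at h
        exact h
    · obtain ⟨f, hfI, hf⟩ := Submodule.exists_mem_ne_zero_of_ne_bot hbot
      have h0 : evg 0 f = 0 := by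
        by_contra h
        exact hI (I.eq_top_of_isUnit_mem hfI ((germ_isUnit_iff f).2 h))
      obtain ⟨ψ, hψ, hψ0, hIntg⟩ := W_gen f h0 hf
      have hfle : Ideal.span {f} ≤ I := by
        rw [Ideal.span_le, Set.singleton_subset_iff]; exact hfI
      have hint2 : ((Ideal.Quotient.mk I).comp (pull 0 0 ψ hψ hψ0)).IsIntegral := by
        have := RingHom.IsIntegral.trans _ _ hIntg (RingHom.isIntegral_of_surjective
          (Ideal.Quotient.factor hfle) (Ideal.Quotient.factor_surjective hfle))
        exact this
      obtain ⟨d, φ, hφ, hφ0, h1, h2⟩ := ih (I.comap (pull 0 0 ψ hψ hψ0)) (Ideal.comap_ne_top _ hI)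
      have hq : (Ideal.quotientMap I (pull 0 0 ψ hψ hψ0) le_rfl).IsIntegral := by
        apply RingHom.IsIntegral.tower_top (Ideal.Quotient.mk (I.comap (pull 0 0 ψ hψ hψ0)))
        exact hint2
      have hA : AnalyticAt ℂ (fun z => φ (ψ z)) 0 :=
        AnalyticAt.fun_comp (g := φ) (by rw [hψ0]; exact hφ) hψ
      have hA0 : (fun z => φ (ψ z)) 0 = 0 := by simp only [hψ0, hφ0]
      have e : (Ideal.Quotient.mk I).comp (pull 0 0 _ hA hA0) =
          (Ideal.quotientMap I (pull 0 0 ψ hψ hψ0) le_rfl).comp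
            ((Ideal.Quotient.mk (I.comap (pull 0 0 ψ hψ hψ0))).comp (pull 0 0 φ hφ hφ0)) := by
        ext x
        simp only [RingHom.comp_apply, Ideal.quotientMap_mk]
        rw [pull_comp hψ hψ0 hφ hφ0 hA hA0]
      refine ⟨d, _, hA, hA0, ?_, ?_⟩
      · rw [e]; exact RingHom.IsIntegral.trans _ _ h1 hq
      · rw [e, RingHom.coe_comp]; exact Ideal.quotientMap_injective.comp h2

lemma dim_RR (n : ℕ) : ringKrullDim (RR n) = n := by
  induction n with
  | zero =>
    apply ringKrullDim_eq_zero_of_isField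
    refine ⟨⟨0, 1, zero_ne_one⟩, mul_comm, ?_⟩
    intro x hx
    have : IsUnit x := by
      rw [germ_isUnit_iff]
      intro h0
      exact hx (by simpa using max_ideal x h0)
    exact this.exists_right_inv
  | succ m ih =>
    apply le_antisymm
    · apply dim_le_succ
      intro f hf
      by_cases h0 : evg 0 f = 0
      · obtain ⟨ψ, hψ, hψ0, hIntg⟩ := W_gen f h0 hf
        exact (dim_le_of_integral _ hIntg).trans ih.le
      · have : Subsingleton (RR (m+1) ⧸ Ideal.span {f}) := by
          rw [Ideal.Quotient.subsingleton_iff]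
          exact Ideal.span_singleton_eq_top.2 ((germ_isUnit_iff f).2 h0)
        rw [ringKrullDim_eq_bot_of_subsingleton]
        exact bot_le
    · have := ringKrullDim_succ_le_of_surjective (rst m) rst_surj (r := zg (Fin.last m)) (by
        apply mem_nonZeroDivisors_of_ne_zero
        intro h
        rw [zg, germ_zero, germ_eq] at h
        have hc : Tendsto (fun t : ℂ => (Pi.single (Fin.last m) t : Fin (m+1) → ℂ)) (𝓝 0) (𝓝 0) := by
          have := (continuous_single (A := fun _ : Fin (m+1) => ℂ) (Fin.last m)).tendsto 0
          simpa using this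
        have h1 := hc.eventually h
        simp only [Pi.single_eq_same] at h1
        have h2 : ∀ᶠ t in 𝓝[≠] (0:ℂ), t = 0 := h1.filter_mono nhdsWithin_le_nhds
        obtain ⟨t, ht, ht2⟩ := (h2.and self_mem_nhdsWithin).exists
        exact ht2 ht) rst_last
      rw [ih] at this
      exact_mod_cast this

end


section
variable {n p : ℕ}

lemma pull_cst {m : ℕ} {a : Fin n → ℂ} {b : Fin m → ℂ} {φ} (hφ hab) (t : ℂ) :
    pull a b φ hφ hab (cst b t) = cst a t := rfl

lemma pow_memJ {d : ℕ} {φ : (Fin n → ℂ) → (Fin d → ℂ)} (hφ : AnalyticAt ℂ φ 0) (hφ0 : φ 0 = 0)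
    (I J : Ideal (RR n)) (hIJ : I ≤ J) (hJ : ∀ k, pull 0 0 φ hφ hφ0 (zg k) ∈ J)
    (hIntg : ((Ideal.Quotient.mk I).comp (pull 0 0 φ hφ hφ0)).IsIntegral) (i : Fin n) :
    ∃ N, (zg i : RR n) ^ N ∈ J := by
  obtain ⟨P, hP, hP0⟩ := hIntg (Ideal.Quotient.mk I (zg i))
  rw [← Polynomial.hom_eval₂, Ideal.Quotient.eq_zero_iff_mem] at hP0
  have h1 := hIJ hP0
  rw [← Ideal.Quotient.eq_zero_iff_mem, Polynomial.hom_eval₂] at h1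
  have hcoef : (Ideal.Quotient.mk J).comp (pull 0 0 φ hφ hφ0) =
      ((Ideal.Quotient.mk J).comp (cst 0)).comp (evg 0) := by
    refine RingHom.ext fun x => ?_
    simp only [RingHom.comp_apply]
    rw [← pull_cst hφ hφ0, Ideal.Quotient.eq, ← map_sub]
    have h2 : x - cst 0 (evg 0 x) ∈ Ideal.span (Set.range (zg (n := d))) := by
      apply max_ideal
      rw [map_sub]
      exact sub_self _
    have h3 := Ideal.mem_map_of_mem (pull 0 0 φ hφ hφ0) h2
    refine (Ideal.map_le_iff_le_comap.2 ?_) h3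
    rw [Ideal.span_le]
    rintro _ ⟨k, rfl⟩
    exact hJ k
  rw [hcoef, ← Polynomial.eval₂_map, ← Polynomial.hom_eval₂, Ideal.Quotient.eq_zero_iff_mem] at h1
  set Q := P.map (evg 0) with hQ
  have hQ0 : Q ≠ 0 := (hP.map _).ne_zero
  obtain ⟨Q', hQ', hnd⟩ := Polynomial.exists_eq_pow_rootMultiplicity_mul_and_not_dvd Q hQ0 0
  refine ⟨Q.rootMultiplicity 0, ?_⟩
  have h4 := congrArg (Polynomial.eval₂ (cst 0) (zg i : RR n)) hQ'
  rw [Polynomial.eval₂_mul, Polynomial.eval₂_pow, Polynomial.eval₂_sub, Polynomial.eval₂_X,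
    Polynomial.eval₂_C, map_zero, sub_zero] at h4
  rw [h4] at h1
  refine (Ideal.mul_unit_mem_iff_mem J (y := Polynomial.eval₂ (cst 0) (zg i) Q') ?_).1 h1
  · rw [germ_isUnit_iff, Polynomial.hom_eval₂]
    have e1 : (evg 0).comp (cst (0 : Fin n → ℂ)) = RingHom.id ℂ := RingHom.ext fun x => rfl
    have e2 : evg 0 (zg i : RR n) = 0 := rfl
    rw [e1, e2]
    intro h
    apply hnd
    rw [Polynomial.dvd_iff_isRoot]
    exact h

lemma sys (hpn : p ≤ n) (f : Fin p → (Fin n → ℂ) → ℂ) (hf : ∀ i, AnalyticAt ℂ (f i) 0)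
    (hf0 : ∀ i, f i 0 = 0)
    (hdim : ringKrullDim (RR n ⧸ (Ideal.span (Set.range fun i => analyticGermAt 0 (f i) (hf i))).radical) =
      ((n - p : ℕ) : WithBot (WithTop ℕ))) :
    ∃ (F : (Fin n → ℂ) → (Fin n → ℂ)) (hF : AnalyticAt ℂ F 0) (hF0 : F 0 = 0),
      (∀ z i, F z (Fin.castLE hpn i) = f i z) ∧
      (∀ i, ∃ N, (zg i : RR n) ^ N ∈ Ideal.span (Set.range fun j => pull 0 0 F hF hF0 (zg j))) ∧
      Function.Injective (pull 0 0 F hF hF0) := by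
  set I := Ideal.span (Set.range fun i => analyticGermAt 0 (f i) (hf i)) with hI
  have hItop : I ≠ ⊤ := by
    intro h
    have : I ≤ RingHom.ker (evg 0) := by
      rw [hI, Ideal.span_le]
      rintro _ ⟨i, rfl⟩
      exact hf0 i
    rw [h, top_le_iff] at this
    exact RingHom.ker_ne_top _ this
  obtain ⟨d, φ, hφ, hφ0, hIntg, hinj⟩ := NN n I hItop
  have hdim2 : ringKrullDim (RR n ⧸ I) = ((n - p : ℕ) : WithBot ℕ∞) := by
    rw [ringKrullDim_quotient, PrimeSpectrum.zeroLocus_radical] at hdim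
    rw [ringKrullDim_quotient]
    exact hdim
  have hd : d = n - p := by
    have h1 := dim_le_of_integral _ hIntg
    have h2 := dim_ge_of_integral _ hIntg hinj
    have h3 := le_antisymm h2 h1
    rw [dim_RR, hdim2] at h3
    exact_mod_cast h3
  subst hd
  let F : (Fin n → ℂ) → (Fin n → ℂ) := fun z j =>
    if h : j.1 < p then f ⟨j.1, h⟩ z else φ z ⟨j.1 - p, by omega⟩
  have hF : AnalyticAt ℂ F 0 := by
    apply pi_analytic
    intro j
    by_cases h : j.1 < p
    · simpa [F, h] using hf ⟨j.1, h⟩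
    · simpa [F, h] using comp_analytic hφ ⟨j.1 - p, by omega⟩
  have hF0 : F 0 = 0 := by
    funext j
    by_cases h : j.1 < p
    · simp [F, h, hf0]
    · simp [F, h, hφ0]
  have hpow : ∀ i, ∃ N, (zg i : RR n) ^ N ∈ Ideal.span (Set.range fun j => pull 0 0 F hF hF0 (zg j)) := by
    apply pow_memJ hφ hφ0 I _ _ _ hIntg
    · rw [hI, Ideal.span_le]
      rintro _ ⟨i, rfl⟩
      refine Ideal.subset_span ⟨Fin.castLE hpn i, ?_⟩
      dsimp only
      rw [zg, pull_germ, germ_eq]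
      exact Eventually.of_forall fun z => by simp [F]
    · intro k
      refine Ideal.subset_span ⟨⟨p + k.1, by omega⟩, ?_⟩
      dsimp only
      rw [zg, zg, pull_germ, pull_germ, germ_eq]
      exact Eventually.of_forall fun z => by simp [F]
  refine ⟨F, hF, hF0, ?_, hpow, ?_⟩
  · intro z i
    simp [F]
  · have hFi := FLgerm hF hF0 hpow
    rw [RingHom.injective_iff_ker_eq_bot]
    by_contra hne
    obtain ⟨g, hg, hg0⟩ := Submodule.exists_mem_ne_zero_of_ne_bot hne
    have h1 : (RingHom.kerLift (pull 0 0 F hF hF0)).IsIntegral :=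
      RingHom.IsIntegral.tower_top (Ideal.Quotient.mk _) _ hFi
    have h2 := dim_le_of_integral _ h1
    have h3 := ringKrullDim_succ_le_of_surjective (Ideal.Quotient.mk (RingHom.ker (pull 0 0 F hF hF0)))
      Ideal.Quotient.mk_surjective (mem_nonZeroDivisors_of_ne_zero hg0) (Ideal.Quotient.eq_zero_iff_mem.2 hg)
    have h4 := (add_le_add_left h2 1).trans h3
    rw [dim_RR] at h4
    have h5 : n + 1 ≤ n := by exact_mod_cast h4
    omega

/-- translation -/
lemma dim_translate (x : Fin n → ℂ) (f : Fin p → (Fin n → ℂ) → ℂ) (hf : ∀ i, AnalyticAt ℂ (f i) x)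
    (hf' : ∀ i, AnalyticAt ℂ (fun z => f i (x + z)) 0) :
    ringKrullDim (AnalyticGermRingAt x ⧸ (Ideal.span (Set.range fun i => analyticGermAt x (f i) (hf i))).radical) =
    ringKrullDim (RR n ⧸ (Ideal.span (Set.range fun i => analyticGermAt 0 _ (hf' i))).radical) := by
  have hA : AnalyticAt ℂ (fun z => x + z) 0 := analyticAt_const.add analyticAt_id
  have hB : AnalyticAt ℂ (fun z => z - x) x := analyticAt_id.sub analyticAt_const
  have hA0 : (fun z => x + z) 0 = x := by simp
  have hB0 : (fun z => z - x) x = 0 := by simp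
  let e : AnalyticGermRingAt x ≃+* RR n := RingEquiv.ofRingHom (pull 0 x _ hA hA0) (pull x 0 _ hB hB0)
    (by
      refine RingHom.ext fun y => ?_
      obtain ⟨g, hg, rfl⟩ := germ_rep y
      rw [RingHom.comp_apply, pull_germ, pull_germ]
      change _ = analyticGermAt 0 g hg
      rw [germ_eq]
      exact Eventually.of_forall fun z => by simp)
    (by
      refine RingHom.ext fun y => ?_
      obtain ⟨g, hg, rfl⟩ := germ_rep y
      rw [RingHom.comp_apply, pull_germ, pull_germ]
      change _ = analyticGermAt x g hg
      rw [germ_eq]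
      exact Eventually.of_forall fun z => by simp)
  rw [ringKrullDim_quotient, ringKrullDim_quotient, PrimeSpectrum.zeroLocus_radical,
    PrimeSpectrum.zeroLocus_radical, ← ringKrullDim_quotient, ← ringKrullDim_quotient]
  refine ringKrullDim_eq_of_ringEquiv (Ideal.quotientEquiv _ _ e ?_)
  rw [Ideal.map_span, ← Set.range_comp]
  rfl

end


section
variable {n p : ℕ}

lemma char_point {r : ℝ} (hr : 0 < r) (χ : HA n r →ₐ[ℂ] ℂ) (hχ : Continuous χ)
    (hb : ∀ h, ‖χ h‖ ≤ ‖h‖) : ∃ ζ : KB n r, ∀ h : HA n r, χ h = h.1 ζ := by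
  have hn : ∀ i, ‖crd n r i‖ ≤ r := by
    intro i
    change ‖crdC n r i‖ ≤ r
    rw [ContinuousMap.norm_le _ hr.le]
    intro z
    have h1 := z.2
    rw [mem_closedBall_zero_iff] at h1
    exact (norm_le_pi_norm z.1 i).trans h1
  let ζ : KB n r := ⟨fun i => χ (crd n r i), by
    rw [mem_closedBall_zero_iff, pi_norm_le_iff_of_nonneg hr.le]
    exact fun i => (hb _).trans (hn i)⟩
  let ev : HA n r →ₐ[ℂ] ℂ := (ContinuousMap.evalAlgHom ℂ ℂ ζ).comp (HA n r).val
  have hev : Continuous ev := (continuous_eval_const ζ).comp continuous_subtype_val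
  refine ⟨ζ, fun h => ?_⟩
  have hcl : IsClosed ((AlgHom.equalizer χ ev : Subalgebra ℂ (HA n r)) : Set (HA n r)) :=
    isClosed_eq hχ hev
  have := HA_le ((AlgHom.equalizer χ ev).map (HA n r).val)
    (((HA_isClosed n r).isClosedEmbedding_subtypeVal).isClosedMap _ hcl) (fun i => ⟨crd n r i, rfl, rfl⟩)
  obtain ⟨g, hg, hgh⟩ := this h.2
  have : g = h := Subtype.ext hgh
  subst this
  exact hg

lemma nullst {r : ℝ} (hr : 0 < r) {q : ℕ} (G : Fin q → HA n r)
    (h : ∀ ζ : KB n r, ∃ j, (G j).1 ζ ≠ 0) : ∃ b : Fin q → HA n r, ∑ j, b j * G j = 1 := by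
  rw [← Ideal.mem_span_range_iff_exists_fun, ← Ideal.eq_top_iff_one]
  by_contra hne
  obtain ⟨M, hM, hle⟩ := Ideal.exists_le_maximal _ hne
  let χ := M.toCharacterSpace
  have h0 : ∀ x ∈ M, χ x = 0 := fun x hx => M.toCharacterSpace_apply_eq_zero_of_mem hx
  obtain ⟨ζ, hζ⟩ := char_point hr (WeakDual.CharacterSpace.toAlgHom χ) (map_continuous χ) (by
    intro h
    have : Nontrivial (HA n r) := (WeakDual.CharacterSpace.toAlgHom χ).toRingHom.domain_nontrivial
    have : NormOneClass (HA n r) := ⟨by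
      have : Nonempty (KB n r) := ⟨⟨0, Metric.mem_closedBall_self hr.le⟩⟩
      change ‖(1 : C(KB n r, ℂ))‖ = 1
      exact norm_one⟩
    exact AlgHom.norm_apply_le_self (WeakDual.CharacterSpace.toAlgHom χ) h)
  obtain ⟨j, hj⟩ := h ζ
  apply hj
  rw [← hζ]
  exact h0 _ (hle (Ideal.subset_span ⟨j, rfl⟩))

lemma openness {F : (Fin n → ℂ) → (Fin n → ℂ)} (hF : AnalyticAt ℂ F 0) (hF0 : F 0 = 0)
    (h : ∀ i, ∃ N, (zg i : RR n) ^ N ∈ Ideal.span (Set.range fun j => pull 0 0 F hF hF0 (zg j)))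
    (hinj : Function.Injective (pull 0 0 F hF hF0)) {ε : ℝ} (hε : 0 < ε) :
    ∃ η > 0, ∀ c : Fin n → ℂ, ‖c‖ < η → ∃ ζ, ‖ζ‖ < ε ∧ F ζ = c := by
  classical
  choose M hM using h
  let N := Finset.univ.sup M
  have hN : ∀ i, (zg i : RR n) ^ (N+1) ∈ Ideal.span (Set.range fun j => pull 0 0 F hF hF0 (zg j)) := by
    intro i
    have : M i ≤ N + 1 := (Finset.le_sup (f := M) (Finset.mem_univ i)).trans (Nat.le_succ _)
    exact Ideal.mem_of_dvd _ (pow_dvd_pow _ this) (hM i)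
  have hs := setup hF hF0 N hN
  obtain ⟨r, ⟨⟨Φ, a, hΦ, ha⟩, hrε⟩, hr⟩ := ((hs.and
    ((eventually_lt_nhds hε).filter_mono nhdsWithin_le_nhds)).and self_mem_nhdsWithin).exists
  have hr : 0 < r := hr
  obtain ⟨δ, hδ, k, hk1, hk2⟩ := FL hr N Φ a ha
  refine ⟨δ, hδ, fun c hc => ?_⟩
  by_contra hcon
  push Not at hcon
  obtain ⟨b, hb⟩ := nullst hr (fun j => Φ j - algebraMap ℂ (HA n r) (c j)) (by
    intro ζ
    by_contra hall
    push Not at hall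
    refine hcon ζ.1 ((mem_closedBall_zero_iff.1 ζ.2).trans_lt hrε) ?_
    funext j
    have h1 : (Φ j).1 ζ - c j = 0 := hall j
    rw [← hΦ]
    exact sub_eq_zero.1 h1)
  let I := Fin n → Fin (N + 1)
  let A : (Fin n → ℂ) → Matrix I I ℂ := fun w => Matrix.of fun β α =>
    ∑ j, (w j - c j) * k α (b j * mon n r β) w
  let K : (Fin n → ℂ) → ℂ := fun w => (1 - A w).det
  have hA : ∀ β α, AnalyticOnNhd ℂ (fun w => A w β α) (Metric.ball 0 δ) := by
    intro β α w hw
    change AnalyticAt ℂ (fun w : Fin n → ℂ => ∑ j, (w j - c j) * k α (b j * mon n r β) w) w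
    refine Finset.analyticAt_fun_sum (f := fun j w => (w j - c j) * k α (b j * mon n r β) w) _ fun j _ => ?_
    exact ((zi_an j w).sub analyticAt_const).mul (hk1 _ _ w hw)
  have hK : AnalyticOnNhd ℂ K (Metric.ball 0 δ) := by
    intro w hw
    have : K = fun w => ∑ σ : Equiv.Perm I, ((Equiv.Perm.sign σ : ℤ) : ℂ) * ∏ i, ((1 : Matrix I I ℂ) (σ i) i - A w (σ i) i) := by
      funext w
      simp only [K]
      rw [Matrix.det_apply']
      simp only [Matrix.sub_apply]
    rw [this]
    refine Finset.analyticAt_fun_sum _ fun σ _ => analyticAt_const.mul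
      (Finset.analyticAt_fun_prod _ fun i _ => ?_)
    exact analyticAt_const.sub (hA _ _ w hw)
  have hKF : ∀ z : KB n r, F z.1 ∈ Metric.ball (0 : Fin n → ℂ) δ → K (F z.1) = 0 := by
    intro z hz
    have hw : (fun j => (Φ j).1 z) = F z.1 := funext fun j => hΦ j z
    apply Matrix.exists_mulVec_eq_zero_iff.1
    refine ⟨fun α => (mon n r α).1 z, ?_, ?_⟩
    · intro h0
      have h1 := congrFun h0 (fun _ => 0)
      rw [mon_val] at h1
      simp at h1
    · rw [Matrix.sub_mulVec, Matrix.one_mulVec, sub_eq_zero]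
      funext β
      let ev : HA n r →ₐ[ℂ] ℂ := (ContinuousMap.evalAlgHom ℂ ℂ z).comp (HA n r).val
      have h1 : mon n r β = ∑ j, (Φ j - algebraMap ℂ (HA n r) (c j)) * (b j * mon n r β) := by
        conv_lhs => rw [← one_mul (mon n r β), ← hb, Finset.sum_mul]
        refine Finset.sum_congr rfl fun j _ => by ring
      have h2 : ev (mon n r β) = ∑ j, (F z.1 j - c j) * ev (b j * mon n r β) := by
        conv_lhs => rw [h1]
        rw [map_sum]
        refine Finset.sum_congr rfl fun j _ => ?_
        rw [map_mul, map_sub, AlgHom.commutes, ← hΦ]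
        rfl
      have h3 : ∀ j, ev (b j * mon n r β) = ∑ α, k α (b j * mon n r β) (F z.1) * (mon n r α).1 z := by
        intro j
        have := hk2 (b j * mon n r β) z (by rw [hw]; exact hz)
        rw [hw] at this
        exact this
      change ev (mon n r β) = ∑ α, (∑ j, (F z.1 j - c j) * k α (b j * mon n r β) (F z.1)) * (mon n r α).1 z
      rw [h2]
      simp only [h3, Finset.mul_sum, Finset.sum_mul]
      rw [Finset.sum_comm]
      refine Finset.sum_congr rfl fun _ _ => Finset.sum_congr rfl fun _ _ => by ring
  have h0 : (0 : Fin n → ℂ) ∈ Metric.ball (0 : Fin n → ℂ) δ := Metric.mem_ball_self hδ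
  have hg : analyticGermAt 0 K (hK 0 h0) = 0 := by
    apply hinj
    rw [pull_germ, map_zero, germ_zero, germ_eq]
    have e1 : ∀ᶠ z in 𝓝 (0 : Fin n → ℂ), F z ∈ Metric.ball (0 : Fin n → ℂ) δ := by
      apply hF.continuousAt.eventually_mem
      rw [hF0]
      exact Metric.ball_mem_nhds _ hδ
    filter_upwards [e1, Metric.closedBall_mem_nhds (0 : Fin n → ℂ) hr] with z hz1 hz2
    exact hKF ⟨z, hz2⟩ hz1
  rw [germ_zero, germ_eq] at hg
  have hz := hK.eqOn_zero_of_preconnected_of_eventuallyEq_zero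
    (convex_ball _ _).isPreconnected h0 hg
  have hc' : K c = 0 := hz (mem_ball_zero_iff.2 hc)
  have hAc : A c = 0 := by
    ext β α
    simp [A]
  simp only [K, hAc, sub_zero, Matrix.det_one] at hc'
  exact one_ne_zero hc'

end

theorem level_sets_converge {n p : ℕ} (hpn : p ≤ n)
    (U : Set (Fin n → ℂ)) (hU : IsOpen U)
    (f : Fin p → (Fin n → ℂ) → ℂ) (hf : ∀ i, AnalyticOnNhd ℂ (f i) U)
    (T : Set (Fin p → ℂ)) (hT : T ∈ 𝓝 (0 : Fin p → ℂ))
    (hci : ∀ c ∈ T, ∀ x, ∀ hx : x ∈ U, (∀ i, f i x = c i) →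
      ringKrullDim (AnalyticGermRingAt x ⧸
        (Ideal.span (Set.range fun i =>
          analyticGermAt x (fun z => f i z - c i) ((hf i x hx).sub analyticAt_const))).radical) =
        ((n - p : ℕ) : WithBot (WithTop ℕ)))
    (c : ℕ → (Fin p → ℂ)) (hc : ∀ ν, c ν ∈ T)
    (c₀ : Fin p → ℂ) (hc₀ : c₀ ∈ T) (hconv : Filter.Tendsto c Filter.atTop (𝓝 c₀)) :
    (∀ K : Set (Fin n → ℂ), IsCompact K → K ⊆ U →
      {x ∈ U | ∀ i, f i x = c₀ i} ∩ K = ∅ →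
      ∀ᶠ ν in Filter.atTop, {x ∈ U | ∀ i, f i x = c ν i} ∩ K = ∅) ∧
    (∀ Ω : Set (Fin n → ℂ), IsOpen Ω → Ω ⊆ U →
      ({x ∈ U | ∀ i, f i x = c₀ i} ∩ Ω).Nonempty →
      ∀ᶠ ν in Filter.atTop, ({x ∈ U | ∀ i, f i x = c ν i} ∩ Ω).Nonempty) := by
  constructor
  · intro K hK hKU hdisj
    have hcont : ContinuousOn (fun x i => f i x) K :=
      continuousOn_pi.2 fun i => (hf i).continuousOn.mono hKU
    have hcl := (hK.image_of_continuousOn hcont).isClosed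
    have hnot : c₀ ∈ ((fun x i => f i x) '' K)ᶜ := by
      rintro ⟨x, hx, hxc⟩
      have : x ∈ {x ∈ U | ∀ i, f i x = c₀ i} ∩ K := ⟨⟨hKU hx, fun i => congrFun hxc i⟩, hx⟩
      rw [hdisj] at this
      exact this
    filter_upwards [hconv.eventually_mem (hcl.isOpen_compl.mem_nhds hnot)] with ν hν
    rw [Set.eq_empty_iff_forall_notMem]
    rintro x ⟨⟨_, hx⟩, hxK⟩
    exact hν ⟨x, hxK, funext hx⟩
  · rintro Ω hΩ hΩU ⟨x, ⟨hxU, hx⟩, hxΩ⟩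
    have hdim := hci c₀ hc₀ x hxU hx
    have hfx : ∀ i, AnalyticAt ℂ (fun z => f i z - c₀ i) x := fun i => (hf i x hxU).sub analyticAt_const
    have hf' : ∀ i, AnalyticAt ℂ (fun z => f i (x + z) - c₀ i) 0 := fun i => by
      refine AnalyticAt.sub (AnalyticAt.fun_comp (g := f i) (f := fun z => x + z) ?_
        (analyticAt_const.add analyticAt_id)) analyticAt_const
      rw [add_zero]
      exact hf i x hxU
    rw [dim_translate x (fun i z => f i z - c₀ i) hfx hf'] at hdim
    obtain ⟨F, hF, hF0, hFf, hpow, hinj⟩ := sys hpn (fun i z => f i (x + z) - c₀ i) hf'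
      (fun i => by simp [hx i]) hdim
    obtain ⟨ε, hε, hball⟩ := Metric.isOpen_iff.1 hΩ x hxΩ
    obtain ⟨η, hη, hop⟩ := openness hF hF0 hpow hinj hε
    have hlim := (tendsto_iff_norm_sub_tendsto_zero.1 hconv).eventually (gt_mem_nhds hη)
    filter_upwards [hlim] with ν hν
    let c' : Fin n → ℂ := fun j => if h : (j : ℕ) < p then c ν ⟨j, h⟩ - c₀ ⟨j, h⟩ else 0
    have hc' : ‖c'‖ < η := by
      rw [pi_norm_lt_iff hη]
      intro j
      by_cases h : (j : ℕ) < p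
      · simp only [c', h, dif_pos]
        exact (norm_le_pi_norm (c ν - c₀) ⟨j, h⟩).trans_lt hν
      · simp only [c', h, dif_neg, norm_zero, not_false_eq_true]
        exact hη
    obtain ⟨ζ, hζ, hFζ⟩ := hop c' hc'
    have hmem : x + ζ ∈ Ω := hball (by simpa using hζ)
    refine ⟨x + ζ, ⟨hΩU hmem, fun i => ?_⟩, hmem⟩
    have h1 := hFf ζ i
    have h2 : c' (Fin.castLE hpn i) = c ν i - c₀ i := by simp [c']
    rw [hFζ, h2] at h1
    exact (sub_left_inj.1 h1).symm
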